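/- arXiv:1310.7716 — 3 statements merged into one kernel-verified Lean document; each statement's English description precedes it below -/
import Mathlib

section
/- Let r ≥ 1, let A = (a_{νμ}) ∈ M_r(ℝ) have all entries strictly positive, let x, y ∈ (0,1)^r, and let s ∈ ℂ^r satisfy Re s_ν > 0 for every ν and Re(s_1 + ⋯ + s_r) > r. Then Σ_{m ∈ ℤ_{≥0}^r} e(m·y) / ∏_{ν=1}^r (Σ_{μ=1}^r a_{νμ}(x_μ + m_μ))^{s_ν} = 2^r (∏_{ν=1}^r Γ_ℂ(s_ν))^{-1} ∫_{(0,∞)^r} F(tA, x, y) t^s ∏_{ν=1}^r dt_ν/t_ν, the integral being absolutely convergent. -/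
open MeasureTheory

noncomputable section

/-- `e z = exp (2 π i z)` -/
def eC (z : ℂ) : ℂ := Complex.exp (2 * Real.pi * Complex.I * z)

/-- `φ(t,x,y) = e(itx)/(1 - e(y + it))` -/
def phiF (t x y : ℝ) : ℂ := eC (Complex.I * t * x) / (1 - eC (y + Complex.I * t))

/-- `F(t,x,y) = ∏_ν φ(t_ν, x_ν, y_ν)` -/
def FF {r : ℕ} (t x y : Fin r → ℝ) : ℂ := ∏ ν, phiF (t ν) (x ν) (y ν)

/-- `Γ_ℝ(s) = π^(-s/2) Γ(s/2)` -/
def GammaR (s : ℂ) : ℂ := (Real.pi : ℂ) ^ (-s / 2) * Complex.Gamma (s / 2)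

/-- `Γ_ℂ(s) = 2 (2π)^(-s) Γ(s)` -/
def GammaC (s : ℂ) : ℂ := 2 * (2 * (Real.pi : ℂ)) ^ (-s) * Complex.Gamma s

/-- the quasi-character `|t|_χ^s = ∏_ν sgn(t_ν)^{χ(ν)} |t_ν|^{s_ν}` -/
def qchar {r : ℕ} (χ : Fin r → ℕ) (s : Fin r → ℂ) (t : Fin r → ℝ) : ℂ :=
  ∏ ν, ((Real.sign (t ν) : ℂ)) ^ (χ ν) * ((|t ν| : ℝ) : ℂ) ^ (s ν)

/-- the Shintani L-function, defined by the integral representation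
`L(s,A,x,y) = 2^r (∏ Γ_ℂ(s_ν))⁻¹ ∫_{(0,∞)^r} F(tA,x,y) t^s ∏ dt_ν/t_ν` -/
def ShintaniL {r : ℕ} (s : Fin r → ℂ) (A : Matrix (Fin r) (Fin r) ℝ)
    (x y : Fin r → ℝ) : ℂ :=
  2 ^ r * (∏ ν, GammaC (s ν))⁻¹ *
    ∫ t in Set.univ.pi fun _ : Fin r => Set.Ioi (0 : ℝ),
      FF (Matrix.vecMul t A) x y * ∏ ν, (((t ν : ℝ) : ℂ) ^ (s ν) * ((t ν : ℝ) : ℂ)⁻¹)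

/-- the normalized Shintani L-function of parity type χ,
`L_χ(s,A,x,y) = (∏ Γ_ℂ(s_ν))⁻¹ ∫_{(ℝ^×)^r} F(tA,x,y) |t|_χ^s ∏ dt_ν/t_ν` -/
def ShintaniLchi {r : ℕ} (χ : Fin r → ℕ) (s : Fin r → ℂ)
    (A : Matrix (Fin r) (Fin r) ℝ) (x y : Fin r → ℝ) : ℂ :=
  (∏ ν, GammaC (s ν))⁻¹ *
    ∫ t : Fin r → ℝ,
      FF (Matrix.vecMul t A) x y * qchar χ s t * ∏ ν, ((t ν : ℝ) : ℂ)⁻¹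

/-- `Γ_χ(s) = ∏_ν Γ_ℝ(s_ν + χ(ν))` -/
def GammaChi {r : ℕ} (χ : Fin r → ℕ) (s : Fin r → ℂ) : ℂ :=
  ∏ ν, GammaR (s ν + (χ ν : ℂ))

/-- the completed normalized Shintani L-function
`L̂_χ(s,A,x,y) = |det A|^{1/2} Γ_χ(s) L_χ(s,A,x,y)` -/
def ShintaniLhat {r : ℕ} (χ : Fin r → ℕ) (s : Fin r → ℂ)
    (A : Matrix (Fin r) (Fin r) ℝ) (x y : Fin r → ℝ) : ℂ :=
  ((Real.sqrt |A.det| : ℝ) : ℂ) * GammaChi χ s * ShintaniLchi χ s A x y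


lemma aux_integrable {α ι : Type*} [Countable ι] [MeasurableSpace α] {μ : Measure α}
    {F : ι → α → ℂ} {f : α → ℂ} (hf : AEStronglyMeasurable f μ)
    (hF : ∀ i, Integrable (F i) μ) (hsum : Summable fun i => ∫ a, ‖F i a‖ ∂μ)
    (h : ∀ᵐ a ∂μ, HasSum (fun i => F i a) (f a)) :
    Integrable f μ ∧ HasSum (fun i => ∫ a, F i a ∂μ) (∫ a, f a ∂μ) := by
  constructor
  · refine ⟨hf, ?_⟩
    have h1 : ∫⁻ a, ‖f a‖ₑ ∂μ ≤ ∫⁻ a, ∑' i, ‖F i a‖ₑ ∂μ := by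
      apply lintegral_mono_ae
      filter_upwards [h] with a ha
      rw [← ha.tsum_eq]
      exact enorm_tsum_le_tsum_enorm
    refine lt_of_le_of_lt h1 ?_
    rw [lintegral_tsum (fun i => (hF i).1.enorm)]
    have h2 : ∀ i, ∫⁻ a, ‖F i a‖ₑ ∂μ = ENNReal.ofReal (∫ a, ‖F i a‖ ∂μ) := by
      intro i
      rw [ofReal_integral_norm_eq_lintegral_enorm (hF i)]
    simp_rw [h2]
    rw [← ENNReal.ofReal_tsum_of_nonneg (fun i => integral_nonneg fun a => norm_nonneg _) hsum]
    exact ENNReal.ofReal_lt_top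
  · have := hasSum_integral_of_summable_integral_norm hF hsum
    have he : ∫ a, f a ∂μ = ∫ a, ∑' i, F i a ∂μ := by
      apply integral_congr_ae
      filter_upwards [h] with a ha
      exact ha.tsum_eq.symm
    rw [he]
    exact this

lemma aux_pi_sum (n : ℕ) (f : Fin n → ℕ → ℂ) (hf : ∀ i, Summable fun k => ‖f i k‖) :
    (Summable fun m : Fin n → ℕ => ‖∏ i, f i (m i)‖) ∧
    HasSum (fun m : Fin n → ℕ => ∏ i, f i (m i)) (∏ i, ∑' k, f i k) := by
  induction n with
  | zero =>
    constructor
    · exact Summable.of_finite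
    · simp
  | succ n ih =>
    obtain ⟨h1, h2⟩ := ih (fun i => f i.succ) (fun i => hf _)
    have h3 := (hf 0).mul_norm h1
    have h4 : HasSum (fun p : ℕ × (Fin n → ℕ) => f 0 p.1 * ∏ i : Fin n, f i.succ (p.2 i))
        ((∑' k, f 0 k) * ∏ i : Fin n, ∑' k, f i.succ k) := by
      rw [← h2.tsum_eq, tsum_mul_tsum_of_summable_norm (hf 0) h1]
      exact (Summable.of_norm h3).hasSum
    let e : (Fin (n+1) → ℕ) ≃ ℕ × (Fin n → ℕ) := (Fin.insertNthEquiv (fun _ => ℕ) 0).symm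
    let P : ℕ × (Fin n → ℕ) → ℂ := fun p => f 0 p.1 * ∏ i : Fin n, f i.succ (p.2 i)
    have he : (fun m : Fin (n+1) → ℕ => ∏ i, f i (m i)) = P ∘ e := by
      funext m
      rw [Fin.prod_univ_succ]
      rfl
    constructor
    · have h5 : (fun m : Fin (n+1) → ℕ => ‖∏ i, f i (m i)‖) = (fun p => ‖P p‖) ∘ e := by
        funext m
        exact congrArg norm (congrFun he m)
      rw [h5]
      exact (Equiv.summable_iff e).mpr h3
    · rw [he, Fin.prod_univ_succ]
      exact (Equiv.hasSum_iff e).mpr h4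

lemma aux_phi (t x y : ℝ) (ht : 0 < t) :
    (Summable fun k : ℕ => ‖eC ((k * y : ℝ) : ℂ) * Complex.exp (-(2 * Real.pi * t * (x + k) : ℝ))‖) ∧
    ∑' k : ℕ, eC ((k * y : ℝ) : ℂ) * Complex.exp (-(2 * Real.pi * t * (x + k) : ℝ)) = phiF t x y := by
  have h0 : ∀ k : ℕ, eC ((k * y : ℝ) : ℂ) * Complex.exp (-(2 * Real.pi * t * (x + k) : ℝ)) =
      eC (Complex.I * t * x) * (eC (y + Complex.I * t)) ^ k := by
    intro k
    unfold eC
    rw [← Complex.exp_nat_mul, ← Complex.exp_add, ← Complex.exp_add]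
    congr 1
    push_cast
    linear_combination (2 * Real.pi * t * (x + k) : ℂ) * (- Complex.I_sq)
  have hn : ‖eC (y + Complex.I * t)‖ < 1 := by
    unfold eC
    rw [Complex.norm_exp]
    simp
    positivity
  simp_rw [h0]
  constructor
  · simp_rw [norm_mul, norm_pow]
    exact (summable_geometric_of_lt_one (norm_nonneg _) hn).mul_left _
  · rw [tsum_mul_left, tsum_geometric_of_norm_lt_one hn]
    rfl

lemma aux_int (s : ℂ) (hs : 0 < s.re) (c : ℝ) (hc : 0 < c) :
    IntegrableOn (fun u : ℝ => ((u : ℂ) ^ s * (u : ℂ)⁻¹) * Complex.exp (-(2 * Real.pi * c * u : ℝ)))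
      (Set.Ioi 0) ∧
    ∫ u in Set.Ioi (0 : ℝ), ((u : ℂ) ^ s * (u : ℂ)⁻¹) * Complex.exp (-(2 * Real.pi * c * u : ℝ)) =
      GammaC s / 2 / (c : ℂ) ^ s ∧
    ∫ u in Set.Ioi (0 : ℝ), ‖((u : ℂ) ^ s * (u : ℂ)⁻¹) * Complex.exp (-(2 * Real.pi * c * u : ℝ))‖ =
      (1 / (2 * Real.pi)) ^ s.re * Real.Gamma s.re * c ^ (-s.re) := by
  have hp : 0 < 2 * Real.pi * c := by positivity
  have hn : ∀ u ∈ Set.Ioi (0 : ℝ),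
      ‖((u : ℂ) ^ s * (u : ℂ)⁻¹) * Complex.exp (-(2 * Real.pi * c * u : ℝ))‖ =
      u ^ (s.re - 1) * Real.exp (-(2 * Real.pi * c * u)) := by
    intro u hu
    have hu' : 0 < u := hu
    rw [norm_mul, norm_mul, norm_inv, Complex.norm_cpow_eq_rpow_re_of_pos hu', Complex.norm_exp,
      Real.rpow_sub_one hu'.ne', Complex.norm_real, Real.norm_of_nonneg hu'.le]
    simp [div_eq_mul_inv]
  have hI : IntegrableOn (fun u : ℝ => u ^ (s.re - 1) * Real.exp (-(2 * Real.pi * c * u)))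
      (Set.Ioi 0) := by
    have := integrableOn_rpow_mul_exp_neg_mul_rpow (p := 1) (s := s.re - 1) (b := 2 * Real.pi * c)
      (by linarith) one_pos hp
    simpa using this
  refine ⟨?_, ?_, ?_⟩
  · have hm : Measurable (fun u : ℝ => ((u : ℂ) ^ s * (u : ℂ)⁻¹) *
        Complex.exp (-(2 * Real.pi * c * u : ℝ))) := by fun_prop
    refine (integrable_norm_iff hm.aestronglyMeasurable).mp ?_
    exact hI.congr_fun (fun u hu => (hn u hu).symm) measurableSet_Ioi
  · have := Complex.integral_cpow_mul_exp_neg_mul_Ioi hs hp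
    rw [setIntegral_congr_fun (g := fun u : ℝ => (u : ℂ) ^ (s - 1) *
      Complex.exp (-(((2 * Real.pi * c : ℝ) : ℂ) * u))) measurableSet_Ioi, this]
    · unfold GammaC
      have e1 : (1 / ((2 * Real.pi * c : ℝ) : ℂ)) ^ s =
          (2 * (Real.pi : ℂ)) ^ (-s) / (c : ℂ) ^ s := by
        have e2 : (1 / ((2 * Real.pi * c : ℝ) : ℂ)) = (((2 * Real.pi)⁻¹ : ℝ) : ℂ) * ((c⁻¹ : ℝ) : ℂ) := by
          push_cast
          rw [one_div, mul_inv]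
        rw [e2, Complex.mul_cpow_ofReal_nonneg (by positivity) (by positivity)]
        rw [Complex.ofReal_inv, Complex.ofReal_inv, Complex.inv_cpow, Complex.inv_cpow,
          Complex.cpow_neg]
        · push_cast; rfl
        · rw [Complex.arg_ofReal_of_nonneg hc.le]; exact Real.pi_pos.ne
        · rw [Complex.arg_ofReal_of_nonneg (by positivity)]; exact Real.pi_pos.ne
      rw [e1]
      ring
    · intro u hu
      have hu' : (u : ℂ) ≠ 0 := by exact_mod_cast (ne_of_gt hu)
      simp only
      rw [Complex.cpow_sub _ _ hu', Complex.cpow_one]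
      push_cast
      rfl
  · rw [setIntegral_congr_fun measurableSet_Ioi hn]
    rw [Real.integral_rpow_mul_exp_neg_mul_Ioi hs hp]
    rw [show 1 / (2 * Real.pi * c) = (1 / (2 * Real.pi)) * c⁻¹ by field_simp,
      Real.mul_rpow (by positivity) (by positivity), Real.inv_rpow hc.le, Real.rpow_neg hc.le]
    ring

lemma aux_summable1 (x p : ℝ) (hx : 0 < x) (hp : 1 < p) :
    Summable fun k : ℕ => (x + k) ^ (-p) := by
  have := (Real.summable_one_div_nat_add_rpow x p).mpr hp
  refine this.congr fun k => ?_
  rw [abs_of_pos (by positivity), Real.rpow_neg (by positivity), one_div, add_comm]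

lemma aux_summable (r : ℕ) (hr : 1 ≤ r) (A : Matrix (Fin r) (Fin r) ℝ)
    (hA : ∀ ν μ, 0 < A ν μ) (x : Fin r → ℝ) (hx : ∀ ν, 0 < x ν)
    (σ : Fin r → ℝ) (hσ : ∀ ν, 0 < σ ν) (hσ' : (r : ℝ) < ∑ ν, σ ν) :
    Summable fun m : Fin r → ℕ => ∏ ν, (∑ μ, A ν μ * (x μ + (m μ : ℝ))) ^ (-σ ν) := by
  have : Nonempty (Fin r) := ⟨⟨0, hr⟩⟩
  obtain ⟨⟨i, j⟩, hij⟩ := Finite.exists_min (fun p : Fin r × Fin r => A p.1 p.2)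
  set a := A i j with ha
  have ha0 : 0 < a := hA i j
  have hr0 : (0 : ℝ) < r := by exact_mod_cast hr
  set p := (∑ ν, σ ν) / r with hp
  have hp1 : 1 < p := by rw [hp, lt_div_iff₀ hr0]; linarith
  have h1 := (aux_pi_sum r (fun μ k => (((x μ + k) ^ (-p) : ℝ) : ℂ)) (fun μ => by
    simpa using (aux_summable1 (x μ) p (hx μ) hp1).abs)).1
  refine Summable.of_nonneg_of_le (fun m => ?_) (fun m => ?_) (h1.mul_left (∏ ν, a ^ (-σ ν)))
  · refine Finset.prod_nonneg fun ν _ => Real.rpow_nonneg ?_ _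
    exact Finset.sum_nonneg fun μ _ => mul_nonneg (hA ν μ).le (by have := hx μ; positivity)
  · have hz : ∀ μ, 0 < x μ + m μ := fun μ => by have := hx μ; positivity
    set S := ∑ μ, (x μ + (m μ : ℝ)) with hS
    have hS0 : 0 < S := Finset.sum_pos (fun μ _ => hz μ) Finset.univ_nonempty
    have hle : ∀ μ, x μ + m μ ≤ S := fun μ =>
      Finset.single_le_sum (f := fun μ => x μ + (m μ : ℝ)) (fun μ _ => (hz μ).le) (Finset.mem_univ μ)
    have hb : ∀ ν, a * S ≤ ∑ μ, A ν μ * (x μ + (m μ : ℝ)) := fun ν => by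
      rw [hS, Finset.mul_sum]
      exact Finset.sum_le_sum fun μ _ => mul_le_mul_of_nonneg_right (hij (ν, μ)) (hz μ).le
    calc ∏ ν, (∑ μ, A ν μ * (x μ + (m μ : ℝ))) ^ (-σ ν)
        ≤ ∏ ν, (a * S) ^ (-σ ν) := by
          refine Finset.prod_le_prod (fun ν _ => ?_) (fun ν _ => ?_)
          · exact Real.rpow_nonneg (le_trans (by positivity) (hb ν)) _
          · exact Real.rpow_le_rpow_of_nonpos (by positivity) (hb ν) (by linarith [hσ ν])
      _ = (∏ ν, a ^ (-σ ν)) * ∏ ν, S ^ (-σ ν) := by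
          rw [← Finset.prod_mul_distrib]
          exact Finset.prod_congr rfl fun ν _ => Real.mul_rpow ha0.le hS0.le
      _ = (∏ ν, a ^ (-σ ν)) * ∏ μ : Fin r, S ^ (-p) := by
          congr 1
          rw [← Real.rpow_sum_of_pos hS0, Finset.prod_const, ← Real.rpow_mul_natCast hS0.le]
          congr 1
          rw [hp, Finset.sum_neg_distrib, Finset.card_univ, Fintype.card_fin]
          field_simp
      _ ≤ (∏ ν, a ^ (-σ ν)) * ∏ μ : Fin r, (x μ + (m μ : ℝ)) ^ (-p) := by
          refine mul_le_mul_of_nonneg_left ?_ (by positivity)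
          refine Finset.prod_le_prod (fun ν _ => by positivity) (fun ν _ => ?_)
          exact Real.rpow_le_rpow_of_nonpos (hz ν) (hle ν) (by linarith)
      _ ≤ _ := by
          refine mul_le_mul_of_nonneg_left ?_ (by positivity)
          rw [← Complex.ofReal_prod, Complex.norm_real]
          exact le_abs_self _

theorem stmt_1 (r : ℕ) (hr : 1 ≤ r) (A : Matrix (Fin r) (Fin r) ℝ)
    (hA : ∀ ν μ, 0 < A ν μ) (x y : Fin r → ℝ)
    (hx : ∀ ν, x ν ∈ Set.Ioo (0 : ℝ) 1) (hy : ∀ ν, y ν ∈ Set.Ioo (0 : ℝ) 1)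
    (s : Fin r → ℂ) (hs : ∀ ν, 0 < (s ν).re) (hs' : (r : ℝ) < (∑ ν, s ν).re) :
    MeasureTheory.IntegrableOn
      (fun t : Fin r → ℝ =>
        FF (Matrix.vecMul t A) x y * ∏ ν, (((t ν : ℝ) : ℂ) ^ (s ν) * ((t ν : ℝ) : ℂ)⁻¹))
      (Set.univ.pi fun _ : Fin r => Set.Ioi (0 : ℝ)) ∧
    HasSum
      (fun m : Fin r → ℕ =>
        eC ((∑ ν, (m ν : ℝ) * y ν : ℝ) : ℂ) /
          ∏ ν, (((∑ μ, A ν μ * (x μ + (m μ : ℝ)) : ℝ) : ℂ)) ^ (s ν))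
      (ShintaniL s A x y) := by
  classical
  have hc : ∀ (m : Fin r → ℕ) ν, 0 < ∑ μ, A ν μ * (x μ + (m μ : ℝ)) := fun m ν =>
    Finset.sum_pos (fun μ _ => mul_pos (hA ν μ) (by have := (hx μ).1; positivity))
      ⟨⟨0, hr⟩, Finset.mem_univ _⟩
  have hmeas : (volume : Measure (Fin r → ℝ)).restrict (Set.univ.pi fun _ => Set.Ioi (0 : ℝ)) =
      Measure.pi fun _ => (volume : Measure ℝ).restrict (Set.Ioi 0) := by
    rw [volume_pi, Measure.restrict_pi_pi]
  let g : (Fin r → ℕ) → Fin r → ℝ → ℂ := fun m ν u => ((u : ℂ) ^ (s ν) * (u : ℂ)⁻¹) *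
    Complex.exp (-(2 * Real.pi * (∑ μ, A ν μ * (x μ + (m μ : ℝ))) * u : ℝ))
  let F : (Fin r → ℕ) → (Fin r → ℝ) → ℂ := fun m t =>
    eC ((∑ ν, (m ν : ℝ) * y ν : ℝ) : ℂ) * ∏ ν, g m ν (t ν)
  have hg := fun m ν => aux_int (s ν) (hs ν) _ (hc m ν)
  have heC : ∀ a : ℝ, ‖eC (a : ℂ)‖ = 1 := fun a => by
    unfold eC
    rw [Complex.norm_exp]
    simp
  have hFint : ∀ m, IntegrableOn (F m) (Set.univ.pi fun _ : Fin r => Set.Ioi (0 : ℝ)) := by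
    intro m
    unfold IntegrableOn
    rw [hmeas]
    exact (Integrable.fintype_prod (fun ν => (hg m ν).1)).const_mul _
  have hFval : ∀ m, ∫ t in Set.univ.pi fun _ : Fin r => Set.Ioi (0 : ℝ), F m t =
      eC ((∑ ν, (m ν : ℝ) * y ν : ℝ) : ℂ) *
        ∏ ν, (GammaC (s ν) / 2 / ((∑ μ, A ν μ * (x μ + (m μ : ℝ)) : ℝ) : ℂ) ^ (s ν)) := by
    intro m
    rw [hmeas, integral_const_mul, integral_fintype_prod_eq_prod]
    congr 1
    exact Finset.prod_congr rfl fun ν _ => (hg m ν).2.1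
  have hFnorm : ∀ m, ∫ t in Set.univ.pi fun _ : Fin r => Set.Ioi (0 : ℝ), ‖F m t‖ =
      (∏ ν, ((1 / (2 * Real.pi)) ^ (s ν).re * Real.Gamma (s ν).re)) *
        ∏ ν, (∑ μ, A ν μ * (x μ + (m μ : ℝ))) ^ (-(s ν).re) := by
    intro m
    have : ∀ t, ‖F m t‖ = ∏ ν, ‖g m ν (t ν)‖ := fun t => by
      simp only [F]
      rw [norm_mul, heC, one_mul, norm_prod]
    simp_rw [this]
    rw [hmeas, integral_fintype_prod_eq_prod (fun ν u => ‖g m ν u‖), ← Finset.prod_mul_distrib]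
    exact Finset.prod_congr rfl fun ν _ => (hg m ν).2.2
  have hsum : Summable fun m => ∫ t in Set.univ.pi fun _ : Fin r => Set.Ioi (0 : ℝ), ‖F m t‖ := by
    simp_rw [hFnorm]
    refine (aux_summable r hr A hA x (fun ν => (hx ν).1) (fun ν => (s ν).re) hs ?_).mul_left _
    simpa using hs'
  have hae : ∀ᵐ t ∂(volume : Measure (Fin r → ℝ)).restrict (Set.univ.pi fun _ => Set.Ioi (0 : ℝ)),
      HasSum (fun m => F m t)
        (FF (Matrix.vecMul t A) x y * ∏ ν, (((t ν : ℝ) : ℂ) ^ (s ν) * ((t ν : ℝ) : ℂ)⁻¹)) := by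
    filter_upwards [ae_restrict_mem (MeasurableSet.univ_pi fun _ => measurableSet_Ioi)] with t ht
    have ht' : ∀ ν, 0 < t ν := fun ν => ht ν (Set.mem_univ _)
    have hv : ∀ μ, 0 < Matrix.vecMul t A μ := fun μ => by
      simp only [Matrix.vecMul, dotProduct]
      exact Finset.sum_pos (fun ν _ => mul_pos (ht' ν) (hA ν μ)) ⟨⟨0, hr⟩, Finset.mem_univ _⟩
    have hphi := fun μ => aux_phi (Matrix.vecMul t A μ) (x μ) (y μ) (hv μ)
    have h1 := (aux_pi_sum r _ (fun μ => (hphi μ).1)).2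
    simp_rw [(hphi _).2] at h1
    have h2 := h1.mul_right (∏ ν, (((t ν : ℝ) : ℂ) ^ (s ν) * ((t ν : ℝ) : ℂ)⁻¹))
    refine HasSum.congr_fun h2 fun m => ?_
    simp only [F, g]
    simp_rw [Finset.prod_mul_distrib, ← Complex.exp_sum]
    have e1 : eC ((∑ ν, (m ν : ℝ) * y ν : ℝ) : ℂ) = ∏ ν, eC (((m ν : ℝ) * y ν : ℝ) : ℂ) := by
      unfold eC
      rw [← Complex.exp_sum, Complex.ofReal_sum, Finset.mul_sum]
    have e2 : ∑ ν, (-((2 * Real.pi * (∑ μ, A ν μ * (x μ + (m μ : ℝ))) * t ν : ℝ) : ℂ)) =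
        ∑ μ, (-((2 * Real.pi * Matrix.vecMul t A μ * (x μ + (m μ : ℝ)) : ℝ) : ℂ)) := by
      simp only [Matrix.vecMul, dotProduct]
      push_cast
      simp_rw [Finset.mul_sum, Finset.sum_mul, ← Finset.sum_neg_distrib]
      rw [Finset.sum_comm]
      exact Finset.sum_congr rfl fun μ _ => Finset.sum_congr rfl fun ν _ => by ring
    rw [e1, e2]
    ring
  have hmf : Measurable (fun t : Fin r → ℝ =>
        FF (Matrix.vecMul t A) x y * ∏ ν, (((t ν : ℝ) : ℂ) ^ (s ν) * ((t ν : ℝ) : ℂ)⁻¹)) := by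
    unfold FF phiF eC
    simp only [Matrix.vecMul, dotProduct]
    fun_prop
  obtain ⟨hi, hS⟩ := aux_integrable hmf.aestronglyMeasurable hFint hsum hae
  refine ⟨hi, ?_⟩
  unfold ShintaniL
  have h3 := hS.mul_left (2 ^ r * (∏ ν, GammaC (s ν))⁻¹)
  refine HasSum.congr_fun h3 fun m => ?_
  rw [hFval, Finset.prod_div_distrib, Finset.prod_div_distrib, Finset.prod_const,
    Finset.card_univ, Fintype.card_fin]
  have hG : ∏ ν, GammaC (s ν) ≠ 0 := by
    refine Finset.prod_ne_zero_iff.mpr fun ν _ => ?_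
    unfold GammaC
    refine mul_ne_zero (mul_ne_zero two_ne_zero ?_) (Complex.Gamma_ne_zero_of_re_pos (hs ν))
    rw [Complex.cpow_ne_zero_iff]
    left
    exact mul_ne_zero two_ne_zero (by exact_mod_cast Real.pi_pos.ne')
  field_simp

end
end

section
/- (Functional equation of the normalized Shintani L-function.) Let r ≥ 1, χ : {1,…,r} → {0,1}, A ∈ GL_r(ℝ), x, y ∈ (0,1)^r, and s ∈ ℂ^r with 0 < Re s_ν < 1 for every ν. Then L̂_χ(s, A, x, y) = i_χ · e(−x·y) · L̂_χ(1−s, A*, y, 1−x), where 1−s = (1−s_1,…,1−s_r), 1−x = (1−x_1,…,1−x_r), and A* = (Aᵀ)^{−1}. -/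
open MeasureTheory

noncomputable section

lemma phi_den_lower (y ρ : ℝ) (hρ : 0 ≤ ρ) :
    |Real.sin (Real.pi * y)| * (1 + ρ) ≤
      ‖1 - Complex.exp (2 * Real.pi * Complex.I * y) * ρ‖ := by
  have h1 : Complex.exp (2 * Real.pi * Complex.I * y) =
      ⟨Real.cos (2 * Real.pi * y), Real.sin (2 * Real.pi * y)⟩ := by
    rw [show (2 * Real.pi * Complex.I * y : ℂ) = ((2 * Real.pi * y : ℝ) : ℂ) * Complex.I by
      push_cast; ring, Complex.exp_mul_I, ← Complex.ofReal_cos, ← Complex.ofReal_sin]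
    apply Complex.ext <;> simp [-Complex.ofReal_cos, -Complex.ofReal_sin]
  have h2 : ‖1 - Complex.exp (2 * Real.pi * Complex.I * y) * ρ‖ ^ 2 =
      1 - 2 * ρ * Real.cos (2 * Real.pi * y) + ρ ^ 2 := by
    rw [Complex.sq_norm, h1, Complex.normSq_apply]
    simp
    nlinarith [Real.sin_sq_add_cos_sq (2 * Real.pi * y)]
  have h3 : Real.cos (2 * Real.pi * y) = 1 - 2 * Real.sin (Real.pi * y) ^ 2 := by
    rw [show 2 * Real.pi * y = 2 * (Real.pi * y) by ring, Real.cos_two_mul]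
    nlinarith [Real.sin_sq_add_cos_sq (Real.pi * y)]
  apply abs_le_of_sq_le_sq' _ (norm_nonneg _) |>.2
  rw [h2, mul_pow, sq_abs, h3]
  nlinarith [mul_nonneg (sub_nonneg.2 (Real.sin_sq_le_one (Real.pi * y))) (sq_nonneg (1 - ρ))]

lemma sin_pi_pos {y : ℝ} (hy : y ∈ Set.Ioo (0 : ℝ) 1) : 0 < Real.sin (Real.pi * y) := by
  apply Real.sin_pos_of_pos_of_lt_pi
  · exact mul_pos Real.pi_pos hy.1
  · nlinarith [Real.pi_pos, hy.2]

lemma phi_den_eq (t y : ℝ) : eC (y + Complex.I * t) =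
    Complex.exp (2 * Real.pi * Complex.I * y) * ((Real.exp (-(2 * Real.pi * t)) : ℝ) : ℂ) := by
  rw [eC, Complex.ofReal_exp, ← Complex.exp_add]
  congr 1
  push_cast
  linear_combination (2 * Real.pi * t : ℂ) * Complex.I_sq

lemma phi_den_lower' (t y : ℝ) :
    |Real.sin (Real.pi * y)| * (1 + Real.exp (-(2 * Real.pi * t))) ≤
      ‖1 - eC (y + Complex.I * t)‖ := by
  rw [phi_den_eq]
  exact phi_den_lower y _ (Real.exp_pos _).le

lemma phi_den_ne {y : ℝ} (hy : y ∈ Set.Ioo (0 : ℝ) 1) (t : ℝ) :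
    1 - eC (y + Complex.I * t) ≠ 0 := by
  rw [← norm_pos_iff]
  refine lt_of_lt_of_le ?_ (phi_den_lower' t y)
  have := sin_pi_pos hy
  positivity

lemma phi_cont (x : ℝ) {y : ℝ} (hy : y ∈ Set.Ioo (0 : ℝ) 1) :
    Continuous fun t => phiF t x y := by
  unfold phiF
  refine Continuous.div ?_ ?_ (phi_den_ne hy)
  · unfold eC; fun_prop
  · unfold eC; fun_prop

lemma phi_bound {x y : ℝ} (hx : x ∈ Set.Ioo (0 : ℝ) 1) (hy : y ∈ Set.Ioo (0 : ℝ) 1) :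
    ∃ C m : ℝ, 0 < C ∧ 0 < m ∧ ∀ t, ‖phiF t x y‖ ≤ C * Real.exp (-(m * |t|)) := by
  refine ⟨(Real.sin (Real.pi * y))⁻¹, 2 * Real.pi * min x (1 - x), inv_pos.2 (sin_pi_pos hy),
    mul_pos Real.two_pi_pos (lt_min hx.1 (by linarith [hx.2])), fun t => ?_⟩
  have hs := sin_pi_pos hy
  have h1 : ‖eC (Complex.I * t * x)‖ = Real.exp (-(2 * Real.pi * t * x)) := by
    rw [eC, Complex.norm_exp]; congr 1; simp; ring
  rw [phiF, norm_div, h1]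
  have h2 := phi_den_lower' t y
  rw [abs_of_pos hs] at h2
  rw [div_le_iff₀ (lt_of_lt_of_le (by positivity) h2)]
  have h3 : Real.exp (-(2 * Real.pi * t * x)) ≤
      Real.exp (-(2 * Real.pi * min x (1 - x) * |t|)) * (1 + Real.exp (-(2 * Real.pi * t))) := by
    rw [mul_add, mul_one, ← Real.exp_add]
    rcases le_total 0 t with ht | ht
    · rw [abs_of_nonneg ht]
      have : Real.exp (-(2 * Real.pi * t * x)) ≤ Real.exp (-(2 * Real.pi * min x (1 - x) * t)) := by
        apply Real.exp_le_exp.2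
        have := mul_le_mul_of_nonneg_left (min_le_left x (1-x)) (mul_nonneg Real.two_pi_pos.le ht)
        linarith
      linarith [Real.exp_pos (-(2 * Real.pi * min x (1 - x) * t) + -(2 * Real.pi * t))]
    · rw [abs_of_nonpos ht]
      have : Real.exp (-(2 * Real.pi * t * x)) ≤
          Real.exp (-(2 * Real.pi * min x (1 - x) * -t) + -(2 * Real.pi * t)) := by
        apply Real.exp_le_exp.2
        have := mul_le_mul_of_nonneg_left (min_le_right x (1-x))
          (mul_nonneg Real.two_pi_pos.le (neg_nonneg.2 ht))
        linarith
      linarith [Real.exp_pos (-(2 * Real.pi * min x (1 - x) * -t))]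
  calc _ ≤ _ := h3
    _ = (Real.sin (Real.pi * y))⁻¹ * Real.exp (-(2 * Real.pi * min x (1 - x) * |t|)) *
        (Real.sin (Real.pi * y) * (1 + Real.exp (-(2 * Real.pi * t)))) := by field_simp
    _ ≤ _ := by gcongr

lemma integrable_abs_exp {m a : ℝ} (hm : 0 < m) (ha : 0 < a) :
    Integrable fun t : ℝ => Real.exp (-(m * |t|)) * |t| ^ (a - 1) := by
  have h : IntegrableOn (fun t : ℝ => Real.exp (-(m * |t|)) * |t| ^ (a - 1)) (Set.Ioi 0) := by
    have := integrableOn_rpow_mul_exp_neg_mul_rpow (p := 1) (s := a - 1) (b := m)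
      (by linarith) one_pos hm
    refine this.congr_fun (fun t ht => ?_) measurableSet_Ioi
    simp only [Real.rpow_one, abs_of_pos (Set.mem_Ioi.1 ht)]
    rw [mul_comm, neg_mul]
  rw [← integrableOn_univ, ← Set.Iic_union_Ioi (a := (0:ℝ)), integrableOn_union]
  refine ⟨?_, h⟩
  rw [integrableOn_Iic_iff_integrableOn_Iio]
  have h' : IntegrableOn (fun t : ℝ => Real.exp (-(m * |t|)) * |t| ^ (a - 1)) (Set.Ioi (-0)) := by
    simpa using h
  simpa using h'.comp_neg_Iio

lemma integrable_exp_abs {m : ℝ} (hm : 0 < m) :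
    Integrable fun t : ℝ => Real.exp (-(m * |t|)) := by
  simpa using integrable_abs_exp hm one_pos

lemma phi_integrable {x y : ℝ} (hx : x ∈ Set.Ioo (0 : ℝ) 1) (hy : y ∈ Set.Ioo (0 : ℝ) 1) :
    Integrable fun t => phiF t x y := by
  obtain ⟨C, m, hC, hm, h⟩ := phi_bound hx hy
  exact ((integrable_exp_abs hm).const_mul C).mono' (phi_cont x hy).aestronglyMeasurable
    (Filter.Eventually.of_forall h)
/-- The holomorphic kernel used for the Fourier transform of `phiF`. -/
def KK (w z : ℂ) : ℂ := Complex.exp (-(2 * Real.pi * w * z)) / (1 - Complex.exp (-(2 * Real.pi * z)))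

lemma KK_eq_phi (t x y ξ : ℝ) :
    KK (y + Complex.I * t) (ξ + x * Complex.I) =
      eC (-(x * (y + Complex.I * t))) * (phiF ξ y (1 - x) * eC (-(t * ξ))) := by
  have h : Complex.exp (-(2 * Real.pi * (ξ + x * Complex.I))) =
      eC (((1 - x : ℝ) : ℂ) + Complex.I * ξ) := by
    rw [eC]
    rw [show (2 * Real.pi * Complex.I * (((1 - x : ℝ) : ℂ) + Complex.I * ξ) : ℂ) =
      -(2 * Real.pi * (ξ + x * Complex.I)) + 2 * Real.pi * Complex.I by
        push_cast; linear_combination (2 * Real.pi * ξ : ℂ) * Complex.I_sq]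
    exact (Complex.exp_periodic _).symm
  rw [KK, h, phiF, div_mul_eq_mul_div, mul_div_assoc']
  congr 1
  simp only [eC, ← Complex.exp_add]
  congr 1
  linear_combination (-2 * Real.pi * ξ * y : ℂ) * Complex.I_sq

lemma eC_ne (z : ℂ) : eC z ≠ 0 := Complex.exp_ne_zero _

lemma norm_eC_real (u : ℝ) : ‖eC u‖ = 1 := by
  rw [eC, show (2 * Real.pi * Complex.I * u : ℂ) = ((2 * Real.pi * u : ℝ) : ℂ) * Complex.I by
    push_cast; ring]
  exact Complex.norm_exp_ofReal_mul_I _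

lemma phi_eC_integrable {x y : ℝ} (hx : x ∈ Set.Ioo (0 : ℝ) 1) (hy : y ∈ Set.Ioo (0 : ℝ) 1)
    (t : ℝ) : Integrable fun ξ : ℝ => phiF ξ y (1 - x) * eC (-(t * ξ)) := by
  have hx' : 1 - x ∈ Set.Ioo (0 : ℝ) 1 := ⟨by linarith [hx.2], by linarith [hx.1]⟩
  refine (phi_integrable hy hx').mul_bdd (c := 1) ?_ (Filter.Eventually.of_forall fun ξ => ?_)
  · apply Continuous.aestronglyMeasurable
    unfold eC; fun_prop
  · have := norm_eC_real (-(t * ξ))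
    push_cast at this
    exact this.le

lemma KK_integrable {x y : ℝ} (hx : x ∈ Set.Ioo (0 : ℝ) 1) (hy : y ∈ Set.Ioo (0 : ℝ) 1)
    (t : ℝ) : Integrable fun ξ : ℝ => KK (y + Complex.I * t) (ξ + x * Complex.I) := by
  simp_rw [KK_eq_phi]
  exact (phi_eC_integrable hx hy t).const_mul _

lemma KK_diff (w : ℂ) {z : ℂ} (hz : z.im ∈ Set.Ioo (0 : ℝ) 1) : DifferentiableAt ℂ (KK w) z := by
  unfold KK
  refine DifferentiableAt.div (by fun_prop) (by fun_prop) ?_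
  have hx' : 1 - z.im ∈ Set.Ioo (0 : ℝ) 1 := ⟨by linarith [hz.2], by linarith [hz.1]⟩
  have h := phi_den_ne hx' z.re
  have : Complex.exp (-(2 * Real.pi * z)) = eC (((1 - z.im : ℝ) : ℂ) + Complex.I * z.re) := by
    conv_lhs => rw [← Complex.re_add_im z]
    rw [eC]
    rw [show (2 * Real.pi * Complex.I * (((1 - z.im : ℝ) : ℂ) + Complex.I * z.re) : ℂ) =
      -(2 * Real.pi * (z.re + z.im * Complex.I)) + 2 * Real.pi * Complex.I by
        push_cast; linear_combination (2 * Real.pi * z.re : ℂ) * Complex.I_sq]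
    exact (Complex.exp_periodic _).symm
  rwa [this]

lemma KK_norm_le (t y T u : ℝ) (hu : u ∈ Set.Ioo (0 : ℝ) 1) (hT : T ≠ 0) :
    ‖KK (y + Complex.I * t) (T + u * Complex.I)‖ ≤
      Real.exp (2 * Real.pi * |t|) *
        (Real.exp (-(2 * Real.pi * y * T)) / |1 - Real.exp (-(2 * Real.pi * T))|) := by
  have hpos : 0 < |1 - Real.exp (-(2 * Real.pi * T))| := by
    rw [abs_pos, sub_ne_zero]
    intro h
    have h0 := (Real.exp_eq_one_iff _).1 h.symm
    rw [neg_eq_zero] at h0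
    exact (mul_ne_zero Real.two_pi_pos.ne' hT) h0
  have hden : |1 - Real.exp (-(2 * Real.pi * T))| ≤
      ‖1 - Complex.exp (-(2 * Real.pi * (T + u * Complex.I)))‖ := by
    have h := abs_norm_sub_norm_le (1 : ℂ) (Complex.exp (-(2 * Real.pi * (T + u * Complex.I))))
    rw [Complex.norm_exp] at h
    simpa using h
  have hnum : ‖Complex.exp (-(2 * Real.pi * (y + Complex.I * t) * (T + u * Complex.I)))‖ ≤
      Real.exp (2 * Real.pi * |t|) * Real.exp (-(2 * Real.pi * y * T)) := by
    rw [Complex.norm_exp, ← Real.exp_add]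
    apply Real.exp_le_exp.2
    have h1 : t * u ≤ |t| := by
      calc t * u ≤ |t * u| := le_abs_self _
        _ = |t| * u := by rw [abs_mul, abs_of_pos hu.1]
        _ ≤ |t| := by nlinarith [abs_nonneg t, hu.2]
    have h2 := mul_le_mul_of_nonneg_left h1 Real.two_pi_pos.le
    simp
    linarith
  rw [KK, norm_div, ← mul_div_assoc]
  gcongr

lemma side_tendsto_top {y : ℝ} (hy : y ∈ Set.Ioo (0 : ℝ) 1) :
    Filter.Tendsto (fun T : ℝ => Real.exp (-(2 * Real.pi * y * T)) /
      |1 - Real.exp (-(2 * Real.pi * T))|) Filter.atTop (nhds 0) := by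
  have key : ∀ c : ℝ, 0 < c → Filter.Tendsto (fun T : ℝ => Real.exp (-(c * T)))
      Filter.atTop (nhds 0) := fun c hc =>
    Real.tendsto_exp_neg_atTop_nhds_zero.comp (Filter.tendsto_id.const_mul_atTop hc)
  have h1 := key (2 * Real.pi * y) (mul_pos Real.two_pi_pos hy.1)
  have h2 := ((key (2 * Real.pi) Real.two_pi_pos).const_sub 1).abs
  have := h1.div h2 (by simp)
  rw [zero_div] at this
  exact this

lemma side_tendsto_bot {y : ℝ} (hy : y ∈ Set.Ioo (0 : ℝ) 1) :
    Filter.Tendsto (fun T : ℝ => Real.exp (-(2 * Real.pi * y * (-T))) /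
      |1 - Real.exp (-(2 * Real.pi * (-T)))|) Filter.atTop (nhds 0) := by
  have hy' : 1 - y ∈ Set.Ioo (0 : ℝ) 1 := ⟨by linarith [hy.2], by linarith [hy.1]⟩
  refine (side_tendsto_top hy').congr fun T => ?_
  have : |1 - Real.exp (-(2 * Real.pi * (-T)))| =
      Real.exp (2 * Real.pi * T) * |1 - Real.exp (-(2 * Real.pi * T))| := by
    rw [← abs_of_pos (Real.exp_pos (2 * Real.pi * T)), ← abs_mul,
      mul_sub, ← Real.exp_add, abs_sub_comm]
    simp
  rw [this, ← div_div, ← Real.exp_sub]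
  congr 2
  ring

lemma KK_shift {a b y : ℝ} (ha : a ∈ Set.Ioo (0 : ℝ) 1) (hb : b ∈ Set.Ioo (0 : ℝ) 1)
    (hy : y ∈ Set.Ioo (0 : ℝ) 1) (t : ℝ) :
    ∫ ξ : ℝ, KK (y + Complex.I * t) (ξ + a * Complex.I) =
      ∫ ξ : ℝ, KK (y + Complex.I * t) (ξ + b * Complex.I) := by
  set w : ℂ := y + Complex.I * t with hw
  have huIcc : ∀ u ∈ Set.uIcc a b, u ∈ Set.Ioo (0 : ℝ) 1 := fun u hu =>
    Set.OrdConnected.uIcc_subset (Set.ordConnected_Ioo) ha hb hu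
  have hrect : ∀ T : ℝ, (∫ ξ in (-T)..T, KK w (ξ + a * Complex.I)) -
      (∫ ξ in (-T)..T, KK w (ξ + b * Complex.I)) +
      (Complex.I • ∫ u in a..b, KK w ((T : ℝ) + u * Complex.I)) -
      (Complex.I • ∫ u in a..b, KK w (((-T : ℝ) : ℂ) + u * Complex.I)) = 0 := by
    intro T
    have := Complex.integral_boundary_rect_eq_zero_of_differentiableOn (KK w)
      (⟨-T, a⟩ : ℂ) (⟨T, b⟩ : ℂ) (by
        intro z hz
        rw [Complex.mem_reProdIm] at hz
        exact (KK_diff w (huIcc _ hz.2)).differentiableWithinAt)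
    exact this
  have hA := intervalIntegral_tendsto_integral (KK_integrable ha hy t)
    Filter.tendsto_neg_atTop_atBot Filter.tendsto_id
  have hB := intervalIntegral_tendsto_integral (KK_integrable hb hy t)
    Filter.tendsto_neg_atTop_atBot Filter.tendsto_id
  have hside : ∀ (S : ℝ → ℝ), (∀ᶠ T in Filter.atTop, S T ≠ 0) →
      Filter.Tendsto (fun T => Real.exp (-(2 * Real.pi * y * S T)) /
        |1 - Real.exp (-(2 * Real.pi * S T))|) Filter.atTop (nhds 0) →
      Filter.Tendsto (fun T : ℝ => ∫ u in a..b, KK w ((S T : ℝ) + u * Complex.I))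
        Filter.atTop (nhds 0) := by
    intro S hS hlim
    have hlim2 := (hlim.const_mul (Real.exp (2 * Real.pi * |t|))).mul_const |b - a|
    rw [mul_zero, zero_mul] at hlim2
    refine squeeze_zero_norm' ?_ hlim2
    filter_upwards [hS] with T hT
    refine intervalIntegral.norm_integral_le_of_norm_le_const fun u hu => ?_
    exact KK_norm_le t y (S T) u (huIcc u (Set.uIoc_subset_uIcc hu)) hT
  have hC := hside (fun T => T) (Filter.eventually_ne_atTop 0) (side_tendsto_top hy)
  have hD := hside (fun T => -T) (by simpa using Filter.eventually_ne_atTop (0 : ℝ))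
    (side_tendsto_bot hy)
  have hall := ((hA.sub hB).add (hC.const_smul Complex.I)).sub (hD.const_smul Complex.I)
  have hzero := tendsto_nhds_unique hall (tendsto_const_nhds.congr fun T => (hrect T).symm)
  simpa [sub_eq_zero] using hzero

lemma beta_line {w : ℂ} (hw0 : 0 < w.re) (hw1 : w.re < 1) :
    ∫ t : ℝ, Complex.exp (w * t) / (1 + Complex.exp t) = Real.pi / Complex.sin (Real.pi * w) := by
  have hB : Complex.betaIntegral w (1 - w) = Real.pi / Complex.sin (Real.pi * w) := by
    have h := Complex.Gamma_mul_Gamma_eq_betaIntegral (s := w) (t := 1 - w) hw0 (by simpa using hw1)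
    rw [add_sub_cancel, Complex.Gamma_one, one_mul, Complex.Gamma_mul_Gamma_one_sub] at h
    exact h.symm
  rw [← hB, Complex.betaIntegral, intervalIntegral.integral_of_le zero_le_one,
    integral_Ioc_eq_integral_Ioo, ← Real.range_sigmoid, ← Set.image_univ,
    integral_image_eq_integral_abs_deriv_smul MeasurableSet.univ
      (fun t _ => (Real.hasDerivAt_sigmoid t).hasDerivWithinAt)
      (Real.sigmoid_injective.injOn), setIntegral_univ]
  congr 1
  ext t
  have hσ := Real.sigmoid_pos t
  have hσ1 : 0 < 1 - Real.sigmoid t := by linarith [Real.sigmoid_lt_one t]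
  rw [abs_of_pos (mul_pos hσ hσ1)]
  have e1 : ((1 : ℂ) - (Real.sigmoid t : ℂ)) = ((1 - Real.sigmoid t : ℝ) : ℂ) := by push_cast; rfl
  have e2 : Real.sigmoid t = Real.exp t * (1 - Real.sigmoid t) := by
    rw [← Real.sigmoid_neg, ← Real.sigmoid_mul_rexp_neg, mul_comm, mul_assoc, ← Real.exp_add]
    simp
  have e3 : (1 - Real.sigmoid t) = (1 + Real.exp t)⁻¹ := by
    rw [← Real.sigmoid_neg, Real.sigmoid_def]; simp
  have c1 : ((Real.sigmoid t : ℝ) : ℂ) ≠ 0 := by exact_mod_cast hσ.ne'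
  have c2 : ((1 - Real.sigmoid t : ℝ) : ℂ) ≠ 0 := by exact_mod_cast hσ1.ne'
  rw [e1, Complex.cpow_sub _ _ c1, Complex.cpow_one, show (1 : ℂ) - w - 1 = -w by ring,
    Complex.cpow_neg]
  have e4 : ((Real.sigmoid t : ℝ) : ℂ) ^ w =
      Complex.exp (w * t) * ((1 - Real.sigmoid t : ℝ) : ℂ) ^ w := by
    conv_lhs => rw [e2]
    rw [Complex.ofReal_mul, Complex.mul_cpow_ofReal_nonneg (Real.exp_pos _).le hσ1.le]
    congr 1
    rw [Complex.cpow_def_of_ne_zero (by exact_mod_cast (Real.exp_pos t).ne'), ← Complex.ofReal_log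
      (Real.exp_pos t).le, Real.log_exp, mul_comm]
  have c3 : ((1 - Real.sigmoid t : ℝ) : ℂ) ^ w ≠ 0 := by
    rw [Ne, Complex.cpow_eq_zero_iff]
    exact fun h => c2 h.1
  rw [e4, Complex.real_smul, Complex.ofReal_mul]
  have e5 : (1 + Complex.exp t)⁻¹ = ((1 - Real.sigmoid t : ℝ) : ℂ) := by
    rw [e3]; push_cast; rfl
  rw [div_eq_mul_inv, e5]
  field_simp

lemma KK_half {y : ℝ} (hy : y ∈ Set.Ioo (0 : ℝ) 1) (t : ℝ) :
    ∫ ξ : ℝ, KK (y + Complex.I * t) (ξ + ((1 / 2 : ℝ) : ℂ) * Complex.I) =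
      -Complex.I / (1 - eC (y + Complex.I * t)) := by
  set w : ℂ := y + Complex.I * t with hw
  have hwre : w.re = y := by simp [hw]
  have hfun : ∀ ξ : ℝ, KK w (ξ + ((1 / 2 : ℝ) : ℂ) * Complex.I) =
      eC (-(w / 2)) * (fun v : ℝ => Complex.exp (w * v) / (1 + Complex.exp v))
        (-(2 * Real.pi) * ξ) := by
    intro ξ
    simp only [KK, eC]
    have h1 : Complex.exp (-(2 * Real.pi * (ξ + ((1 / 2 : ℝ) : ℂ) * Complex.I))) =
        - Complex.exp ((-(2 * Real.pi) * ξ : ℝ) : ℂ) := by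
      rw [show (-(2 * Real.pi * (ξ + ((1 / 2 : ℝ) : ℂ) * Complex.I)) : ℂ) =
        ((-(2 * Real.pi) * ξ : ℝ) : ℂ) - Real.pi * Complex.I by push_cast; ring,
        Complex.exp_sub_pi_mul_I]
    rw [h1, sub_neg_eq_add, ← mul_div_assoc, ← Complex.exp_add]
    congr 2
    push_cast
    ring
  simp_rw [hfun]
  rw [integral_const_mul, Measure.integral_comp_mul_left
    (fun v : ℝ => Complex.exp (w * v) / (1 + Complex.exp v)),
    beta_line (by rw [hwre]; exact hy.1) (by rw [hwre]; exact hy.2)]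
  have hne : 1 - eC w ≠ 0 := phi_den_ne hy t
  have habs : |(-(2 * Real.pi))⁻¹| = (2 * Real.pi)⁻¹ := by
    rw [abs_inv, abs_neg, abs_of_pos Real.two_pi_pos]
  rw [habs, Complex.real_smul]
  have e1 : eC w = eC (w / 2) * eC (w / 2) := by
    simp only [eC, ← Complex.exp_add]; congr 1; ring
  have e2 : eC (-(w / 2)) = (eC (w / 2))⁻¹ := by
    simp only [eC, ← Complex.exp_neg]; congr 1; ring
  have e3 : Complex.sin (Real.pi * w) = ((eC (w / 2))⁻¹ - eC (w / 2)) * Complex.I / 2 := by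
    rw [Complex.sin, ← e2]
    simp only [eC]
    congr 4 <;> ring
  have hE := eC_ne (w / 2)
  rw [e1] at hne
  rw [e2, e3, e1]
  have hpi : (Real.pi : ℂ) ≠ 0 := by exact_mod_cast Real.pi_ne_zero
  generalize eC (w / 2) = E at hE hne
  have hne' : E⁻¹ - E ≠ 0 := by
    intro h
    apply hne
    have := congrArg (fun z => E * z) h
    simpa [mul_sub, hE] using this
  have h4 : E⁻¹ - E = (1 - E * E) / E := by field_simp
  rw [h4]
  push_cast
  field_simp
  rw [Complex.I_sq]
  try ring

lemma phi_fourier {x y : ℝ} (hx : x ∈ Set.Ioo (0 : ℝ) 1) (hy : y ∈ Set.Ioo (0 : ℝ) 1) (t : ℝ) :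
    phiF t x y = ∫ ξ : ℝ, Complex.I * eC (-(x * y)) * phiF ξ y (1 - x) * eC (-(t * ξ)) := by
  have h1 := KK_shift hx (b := 1 / 2) ⟨by norm_num, by norm_num⟩ hy t
  rw [KK_half hy t] at h1
  simp_rw [KK_eq_phi] at h1
  rw [integral_const_mul] at h1
  simp_rw [mul_assoc (Complex.I * eC (-(x * y)))]
  rw [integral_const_mul]
  have e0 : eC (x * (y + Complex.I * t)) * eC (-(x * (y + Complex.I * t))) = 1 := by
    rw [eC, eC, ← Complex.exp_add]; simp
  have e1 : eC (Complex.I * t * x) = eC (-(x * y)) * eC (x * (y + Complex.I * t)) := by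
    simp only [eC, ← Complex.exp_add]; congr 1; ring
  rw [phiF, e1]
  linear_combination (norm := skip) (-Complex.I * eC (-(x * y)) * eC (x * (y + Complex.I * t))) * h1
  generalize (∫ ξ : ℝ, phiF ξ y (1 - x) * eC (-(t * ξ))) = J
  linear_combination (eC (-(x * y)) * eC (x * (y + Complex.I * t)) /
    (1 - eC (y + Complex.I * t))) * Complex.I_sq + (Complex.I * eC (-(x * y)) * J) * e0
lemma cpow_pos_eq {a : ℝ} (ha : 0 < a) (z : ℂ) :
    ((a : ℝ) : ℂ) ^ z = Complex.exp (Real.log a * z) := by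
  rw [Complex.cpow_def_of_ne_zero (by exact_mod_cast ha.ne'), Complex.ofReal_log ha.le]

/-- one-dimensional Gaussian kernel -/
def gK (ε : ℕ) (p : ℂ) (t u : ℝ) : ℂ :=
  (t : ℂ) ^ ε * (Complex.exp (-((Real.pi * t ^ 2 : ℝ) * u)) * (u : ℂ) ^ ((p + ε) / 2 - 1))

/-- its Fourier transform -/
def gH (ε : ℕ) (s : ℂ) (t u : ℝ) : ℂ :=
  (-Complex.I) ^ ε * ((|(-1 : ℝ)| * u ^ ((-1 : ℝ) - 1)) • gK ε s t (u ^ (-1 : ℝ)))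

lemma gK_meas (ε : ℕ) (p : ℂ) : Measurable fun q : ℝ × ℝ => gK ε p q.1 q.2 := by
  unfold gK; fun_prop

lemma gH_meas (ε : ℕ) (p : ℂ) : Measurable fun q : ℝ × ℝ => gH ε p q.1 q.2 := by
  unfold gH
  have h : Measurable fun q : ℝ × ℝ => gK ε p q.1 (q.2 ^ (-1 : ℝ)) :=
    (gK_meas ε p).comp (f := fun q : ℝ × ℝ => (q.1, q.2 ^ (-1 : ℝ))) (by fun_prop)
  have h' : Measurable fun q : ℝ × ℝ => (|(-1 : ℝ)| * q.2 ^ ((-1 : ℝ) - 1)) := by fun_prop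
  exact Measurable.const_mul (h'.smul h) _

lemma gK_norm (ε : ℕ) (p : ℂ) (t : ℝ) {u : ℝ} (hu : 0 < u) :
    ((‖gK ε p t u‖ : ℝ) : ℂ) = gK ε (p.re : ℂ) |t| u := by
  have h : ‖gK ε p t u‖ = |t| ^ ε * (Real.exp (-((Real.pi * t ^ 2) * u)) *
      u ^ ((p.re + ε) / 2 - 1)) := by
    rw [gK, norm_mul, norm_mul, norm_pow, Complex.norm_real, Real.norm_eq_abs, Complex.norm_exp,
      Complex.norm_cpow_eq_rpow_re_of_pos hu]
    congr 2
    · congr 1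
      rw [← Complex.ofReal_mul, ← Complex.ofReal_neg, Complex.ofReal_re]
    · simp
  rw [h, gK, sq_abs, Complex.ofReal_mul, Complex.ofReal_mul, Complex.ofReal_cpow hu.le]
  push_cast
  rfl

lemma gK_integrable (ε : ℕ) {p : ℂ} (hp : 0 < p.re) {t : ℝ} (ht : t ≠ 0) :
    IntegrableOn (fun u => gK ε p t u) (Set.Ioi 0) := by
  unfold gK
  refine Integrable.const_mul ?_ _
  have h := integrableOn_rpow_mul_exp_neg_mul_rpow (p := 1) (s := (p.re + ε) / 2 - 1)
    (b := Real.pi * t ^ 2) (by have : (0:ℝ) ≤ ε := by positivity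
                               linarith) one_pos (by positivity)
  refine Integrable.mono' h ?_ ?_
  · exact Measurable.aestronglyMeasurable (by fun_prop)
  · refine (ae_restrict_mem measurableSet_Ioi).mono fun u hu => ?_
    rw [norm_mul, Complex.norm_exp, Complex.norm_cpow_eq_rpow_re_of_pos hu]
    rw [← Complex.ofReal_mul, ← Complex.ofReal_neg, Complex.ofReal_re, mul_comm]
    simp

lemma gK_integral (ε : ℕ) {p : ℂ} (hp : 0 < p.re) {t : ℝ} (ht : t ≠ 0) :
    ∫ u in Set.Ioi (0 : ℝ), gK ε p t u =
      GammaR (p + ε) * ((Real.sign t : ℂ) ^ ε * ((|t| : ℝ) : ℂ) ^ (-p)) := by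
  unfold gK
  have hr : 0 < Real.pi * t ^ 2 := by positivity
  have hre : 0 < ((p + ε) / 2).re := by
    simp
    positivity
  rw [integral_const_mul]
  simp_rw [mul_comm (Complex.exp _)]
  rw [Complex.integral_cpow_mul_exp_neg_mul_Ioi hre hr, GammaR]
  have ht' : 0 < |t| := abs_pos.2 ht
  have e1 : ((1 : ℂ) / ((Real.pi * t ^ 2 : ℝ) : ℂ)) ^ ((p + ε) / 2) =
      (Real.pi : ℂ) ^ (-(p + ε) / 2) * ((|t| : ℝ) : ℂ) ^ (-p) * (((|t| : ℝ) : ℂ) ^ ε)⁻¹ := by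
    have : ((1 : ℂ) / ((Real.pi * t ^ 2 : ℝ) : ℂ)) = (((Real.pi * |t| ^ 2)⁻¹ : ℝ) : ℂ) := by
      rw [sq_abs]; push_cast; simp
    rw [this, cpow_pos_eq (by positivity), cpow_pos_eq Real.pi_pos, cpow_pos_eq ht',
      ← Complex.cpow_natCast, ← Complex.cpow_neg, cpow_pos_eq ht', ← Complex.exp_add,
      ← Complex.exp_add, Real.log_inv, Real.log_mul (by positivity) (by positivity), Real.log_pow]
    congr 1
    push_cast
    ring
  have e2 : (t : ℂ) = (Real.sign t : ℂ) * ((|t| : ℝ) : ℂ) := by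
    rw [← Complex.ofReal_mul]
    congr 1
    rcases lt_or_gt_of_ne ht with h | h
    · simp [Real.sign_of_neg h, abs_of_neg h]
    · simp [Real.sign_of_pos h, abs_of_pos h]
  have c : ((|t| : ℝ) : ℂ) ^ ε ≠ 0 := pow_ne_zero _ (by exact_mod_cast ht'.ne')
  rw [e1]
  conv_lhs => rw [e2, mul_pow]
  rw [show (p + ε) / 2 = (p + ε) / 2 from rfl]
  field_simp

lemma gK_norm_integral (ε : ℕ) {p : ℂ} (hp : 0 < p.re) {t : ℝ} (ht : t ≠ 0) :
    ∫ u in Set.Ioi (0 : ℝ), ‖gK ε p t u‖ = ‖GammaR ((p.re : ℂ) + ε)‖ * |t| ^ (-p.re) := by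
  have ht' : 0 < |t| := abs_pos.2 ht
  have h1 : ((∫ u in Set.Ioi (0 : ℝ), ‖gK ε p t u‖ : ℝ) : ℂ) =
      GammaR ((p.re : ℂ) + ε) * ((|t| : ℝ) : ℂ) ^ (-(p.re : ℂ)) := by
    rw [← integral_complex_ofReal, setIntegral_congr_fun measurableSet_Ioi
      (fun u hu => gK_norm ε p t hu), gK_integral ε (by simpa using hp) ht'.ne',
      Real.sign_of_pos ht']
    simp
  have h2 := congrArg norm h1
  rw [Complex.norm_real, norm_mul, Complex.norm_cpow_eq_rpow_re_of_pos ht', Real.norm_of_nonneg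
    (integral_nonneg fun _ => norm_nonneg _)] at h2
  simpa using h2

lemma gH_integrable (ε : ℕ) {p : ℂ} (hp : 0 < p.re) {t : ℝ} (ht : t ≠ 0) :
    IntegrableOn (fun u => gH ε p t u) (Set.Ioi 0) := by
  unfold gH
  refine Integrable.const_mul ?_ _
  exact (integrableOn_Ioi_comp_rpow_iff (fun u => gK ε p t u) (by norm_num)).2
    (gK_integrable ε hp ht)

lemma gH_integral (ε : ℕ) {p : ℂ} (hp : 0 < p.re) {t : ℝ} (ht : t ≠ 0) :
    ∫ u in Set.Ioi (0 : ℝ), gH ε p t u =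
      (-Complex.I) ^ ε * (GammaR (p + ε) * ((Real.sign t : ℂ) ^ ε * ((|t| : ℝ) : ℂ) ^ (-p))) := by
  unfold gH
  rw [integral_const_mul, integral_comp_rpow_Ioi (fun u => gK ε p t u) (by norm_num),
    gK_integral ε hp ht]

lemma gH_norm_integral (ε : ℕ) {p : ℂ} (hp : 0 < p.re) {t : ℝ} (ht : t ≠ 0) :
    ∫ u in Set.Ioi (0 : ℝ), ‖gH ε p t u‖ = ‖GammaR ((p.re : ℂ) + ε)‖ * |t| ^ (-p.re) := by
  rw [← gK_norm_integral ε hp ht,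
    ← integral_comp_rpow_Ioi (fun u => ‖gK ε p t u‖) (p := -1) (by norm_num)]
  refine setIntegral_congr_fun measurableSet_Ioi fun u hu => ?_
  have hu' : (0 : ℝ) < u := hu
  simp only [gH]
  rw [norm_mul, norm_smul, Real.norm_of_nonneg (by positivity)]
  simp

lemma gK_t_integrable {ε : ℕ} (hε : ε ≤ 1) (p : ℂ) {u : ℝ} (hu : 0 < u) :
    Integrable fun t : ℝ => gK ε p t u := by
  unfold gK
  have hb : 0 < ((Real.pi * u : ℝ) : ℂ).re := by simp; positivity
  interval_cases ε
  · have := (integrable_cexp_neg_mul_sq hb).mul_const ((u : ℂ) ^ ((p + (0 : ℕ)) / 2 - 1))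
    refine this.congr (Filter.Eventually.of_forall fun t => ?_)
    simp only [pow_zero, one_mul]
    congr 2
    push_cast; ring
  · have := (integrable_mul_cexp_neg_mul_sq hb).mul_const ((u : ℂ) ^ ((p + (1 : ℕ)) / 2 - 1))
    refine this.congr (Filter.Eventually.of_forall fun t => ?_)
    simp only [pow_one, mul_assoc]
    congr 3
    push_cast; ring

lemma gauss_fourier_zero {u : ℝ} (hu : 0 < u) (ξ : ℝ) :
    ∫ t : ℝ, Complex.exp (-((Real.pi * t ^ 2 : ℝ) * u)) * eC (-(t * ξ)) =
      Complex.exp (Real.log u * (-1/2)) * Complex.exp (-((Real.pi * ξ ^ 2 : ℝ) / u)) := by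
  have h := congrFun (fourier_gaussian_pi (b := (u : ℂ)) (by simpa using hu)) ξ
  rw [Real.fourier_real_eq_integral_exp_smul] at h
  rw [cpow_pos_eq hu, one_div, ← Complex.exp_neg] at h
  convert h using 1
  · congr 1
    ext t
    rw [smul_eq_mul, mul_comm, eC]
    congr 2 <;> (push_cast; ring)
  · congr 2 <;> (push_cast; ring)

lemma gauss_fourier_one {u : ℝ} (hu : 0 < u) (ξ : ℝ) :
    ∫ t : ℝ, (t * Complex.exp (-((Real.pi * t ^ 2 : ℝ) * u))) * eC (-(t * ξ)) =
      -Complex.I * ξ * Complex.exp (Real.log u * (-3/2)) *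
        Complex.exp (-((Real.pi * ξ ^ 2 : ℝ) / u)) := by
  set f : ℝ → ℂ := fun t => Complex.exp (-Real.pi * u * (t : ℂ) ^ 2) with hf
  have hder : ∀ t : ℝ, HasDerivAt f (-(2 * Real.pi * u) * (t * f t)) t := by
    intro t
    have h1 : HasDerivAt (fun z : ℂ => Complex.exp (-Real.pi * u * z ^ 2))
        (Complex.exp (-Real.pi * u * (t : ℂ) ^ 2) * (-Real.pi * u * (2 * t))) (t : ℂ) := by
      have := ((hasDerivAt_pow 2 (t : ℂ)).const_mul (-Real.pi * u : ℂ)).cexp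
      simpa using this
    have := h1.comp_ofReal
    convert this using 1
    simp only [hf]; ring
  have hb : 0 < ((Real.pi * u : ℝ) : ℂ).re := by simp; positivity
  have hIntg : Integrable f := by
    refine (integrable_cexp_neg_mul_sq hb).congr (Filter.Eventually.of_forall fun t => ?_)
    simp only [hf]; congr 1; push_cast; ring
  have hIntg' : Integrable (fun t : ℝ => (t : ℂ) * f t) := by
    refine (integrable_mul_cexp_neg_mul_sq hb).congr (Filter.Eventually.of_forall fun t => ?_)
    simp only [hf]; congr 2; push_cast; ring
  have hd : deriv f = fun t : ℝ => -(2 * Real.pi * u) * (t * f t) := funext fun t => (hder t).deriv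
  have h := congrFun (Real.fourier_deriv hIntg (fun t => (hder t).differentiableAt)
    (by rw [hd]; exact hIntg'.const_mul _)) ξ
  rw [hd, Real.fourier_real_eq_integral_exp_smul] at h
  have hg : FourierTransform.fourier f ξ = _ :=
    congrFun (fourier_gaussian_pi (b := (u : ℂ)) (by simpa using hu)) ξ
  simp only [hg] at h
  rw [cpow_pos_eq hu, one_div, ← Complex.exp_neg] at h
  have hpi : (Real.pi : ℂ) ≠ 0 := by exact_mod_cast Real.pi_ne_zero
  have hu' : (u : ℂ) ≠ 0 := by exact_mod_cast hu.ne'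
  have hL : ∀ t : ℝ, Complex.exp (((-2 * Real.pi * t * ξ : ℝ) : ℂ) * Complex.I) •
      (-(2 * Real.pi * u : ℂ) * (t * f t)) = -(2 * Real.pi * u : ℂ) *
        ((t * Complex.exp (-((Real.pi * t ^ 2 : ℝ) * u))) * eC (-(t * ξ))) := by
    intro t
    have a1 : f t = Complex.exp (-((Real.pi * t ^ 2 : ℝ) * u)) := by
      simp only [hf]; congr 1; push_cast; ring
    have a2 : Complex.exp (((-2 * Real.pi * t * ξ : ℝ) : ℂ) * Complex.I) = eC (-(t * ξ)) := by
      rw [eC]; congr 1; push_cast; ring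
    rw [a1, a2, smul_eq_mul]; ring
  simp_rw [hL] at h
  rw [integral_const_mul] at h
  have a3 : Complex.exp (-(Real.log u * (1/2))) =
      u * Complex.exp (Real.log u * (-3/2)) := by
    have : (u : ℂ) = Complex.exp (Real.log u) := by
      rw [← Complex.ofReal_exp, Real.exp_log hu]
    calc _ = Complex.exp (Real.log u) * Complex.exp (Real.log u * (-3/2)) := by
          rw [← Complex.exp_add]; congr 1; ring
      _ = _ := by rw [← this]
  have a4 : Complex.exp (-Real.pi / u * (ξ : ℂ) ^ 2) =
      Complex.exp (-((Real.pi * ξ ^ 2 : ℝ) / u)) := by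
    congr 1; push_cast; ring
  rw [a3, a4, smul_eq_mul] at h
  have h2 : -(2 * Real.pi * u : ℂ) ≠ 0 := by simp [hpi, hu']
  apply mul_left_cancel₀ h2
  rw [h]
  ring

lemma gK_fourier {ε : ℕ} (hε : ε ≤ 1) (s : ℂ) {u : ℝ} (hu : 0 < u) (ξ : ℝ) :
    ∫ t : ℝ, gK ε (1 - s) t u * eC (-(t * ξ)) = gH ε s ξ u := by
  have hu1 : (0 : ℝ) < u ^ (-1 : ℝ) := by positivity
  have hlog : Real.log (u ^ (-1 : ℝ)) = - Real.log u := by rw [Real.log_rpow hu]; ring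
  have hinv : (((u ^ (-1 : ℝ) : ℝ)) : ℂ) = (u : ℂ)⁻¹ := by rw [Real.rpow_neg_one]; push_cast; rfl
  have h2 : ((u ^ ((-1 : ℝ) - 1) : ℝ) : ℂ) = Complex.exp (Real.log u * (-2)) := by
    rw [Complex.ofReal_cpow hu.le, cpow_pos_eq hu]; congr 1; push_cast; ring
  unfold gH gK
  rw [Complex.real_smul, Complex.ofReal_mul, h2, cpow_pos_eq hu1, cpow_pos_eq hu, hlog, hinv]
  interval_cases ε
  · simp_rw [pow_zero, one_mul, mul_right_comm _ _ (eC _)]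
    rw [integral_mul_const, gauss_fourier_zero hu]
    simp only [abs_neg, abs_one, Complex.ofReal_one, one_mul, ← Complex.exp_add]
    congr 1
    push_cast
    ring
  · have hc : ∀ t : ℝ, (t : ℂ) ^ 1 * (Complex.exp (-((Real.pi * t ^ 2 : ℝ) * u)) *
        Complex.exp (Real.log u * ((1 - s + (1 : ℕ)) / 2 - 1))) * eC (-(t * ξ)) =
        ((t * Complex.exp (-((Real.pi * t ^ 2 : ℝ) * u))) * eC (-(t * ξ))) *
          Complex.exp (Real.log u * ((1 - s + (1 : ℕ)) / 2 - 1)) := fun t => by ring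
    simp_rw [hc]
    rw [integral_mul_const, gauss_fourier_one hu]
    have e : Complex.exp (Real.log u * (-3/2)) *
        Complex.exp (Real.log u * ((1 - s + (1 : ℕ)) / 2 - 1)) =
        Complex.exp (Real.log u * (-2)) *
          Complex.exp ((-Real.log u : ℝ) * ((s + (1 : ℕ)) / 2 - 1)) := by
      rw [← Complex.exp_add, ← Complex.exp_add]; congr 1; push_cast; ring
    simp only [abs_neg, abs_one, Complex.ofReal_one, one_mul, pow_one, div_eq_mul_inv] at e ⊢
    linear_combination (-Complex.I * ξ *
      Complex.exp (-((Real.pi * ξ ^ 2 : ℝ) * (u : ℂ)⁻¹))) * e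
/-- product of `volume` restricted to the positive half line -/
def muPos (r : ℕ) : Measure (Fin r → ℝ) :=
  Measure.pi fun _ : Fin r => (volume : Measure ℝ).restrict (Set.Ioi 0)

instance (r : ℕ) : SigmaFinite (muPos r) := by unfold muPos; infer_instance

lemma ae_ne_zero_pi (r : ℕ) : ∀ᵐ t : Fin r → ℝ, ∀ ν, t ν ≠ 0 := by
  rw [ae_all_iff]
  intro ν
  have h : ∀ᵐ a : ℝ, a ≠ 0 := by simp [ae_iff, measure_singleton]
  exact (Measure.quasiMeasurePreserving_eval (fun _ : Fin r => (volume : Measure ℝ)) ν).ae h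

lemma ae_pos_muPos (r : ℕ) : ∀ᵐ u ∂(muPos r), ∀ ν, 0 < u ν := by
  rw [ae_all_iff]
  intro ν
  have h : ∀ᵐ a : ℝ ∂(volume.restrict (Set.Ioi 0)), 0 < a := ae_restrict_mem measurableSet_Ioi
  exact (Measure.quasiMeasurePreserving_eval
    (fun _ : Fin r => (volume : Measure ℝ).restrict (Set.Ioi 0)) ν).ae h

lemma swap_mellin {r : ℕ} {f : (Fin r → ℝ) → ℂ} (hf : AEStronglyMeasurable f)
    (G : Fin r → ℝ → ℝ → ℂ) (hGm : ∀ ν, Measurable fun q : ℝ × ℝ => G ν q.1 q.2)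
    (hGi : ∀ ν t, t ≠ 0 → IntegrableOn (G ν t) (Set.Ioi 0))
    (N : Fin r → ℝ → ℝ) (hN : ∀ ν t, t ≠ 0 → ∫ u in Set.Ioi (0 : ℝ), ‖G ν t u‖ = N ν t)
    (hIntg : Integrable fun t : Fin r → ℝ => ‖f t‖ * ∏ ν, N ν (t ν)) :
    ∫ t : Fin r → ℝ, f t * ∏ ν, ∫ u in Set.Ioi (0 : ℝ), G ν (t ν) u =
      ∫ u, (∫ t : Fin r → ℝ, f t * ∏ ν, G ν (t ν) (u ν)) ∂(muPos r) := by
  have hmeas : Measurable fun q : (Fin r → ℝ) × (Fin r → ℝ) => ∏ ν, G ν (q.1 ν) (q.2 ν) := by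
    refine Finset.measurable_fun_prod _ fun ν _ => ?_
    exact (hGm ν).comp (f := fun q : (Fin r → ℝ) × (Fin r → ℝ) => (q.1 ν, q.2 ν)) (by fun_prop)
  have hI : Integrable (fun q : (Fin r → ℝ) × (Fin r → ℝ) => f q.1 * ∏ ν, G ν (q.1 ν) (q.2 ν))
      (volume.prod (muPos r)) := by
    have hm : AEStronglyMeasurable (fun q : (Fin r → ℝ) × (Fin r → ℝ) =>
        f q.1 * ∏ ν, G ν (q.1 ν) (q.2 ν)) (volume.prod (muPos r)) :=
      hf.comp_fst.mul hmeas.aestronglyMeasurable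
    rw [integrable_prod_iff hm]
    constructor
    · filter_upwards [ae_ne_zero_pi r] with t ht
      exact (Integrable.fintype_prod (fun ν => hGi ν (t ν) (ht ν))).const_mul _
    · refine hIntg.congr ?_
      filter_upwards [ae_ne_zero_pi r] with t ht
      simp only [norm_mul, norm_prod]
      rw [integral_const_mul, muPos,
        integral_fintype_prod_eq_prod (fun ν u => ‖G ν (t ν) u‖)]
      congr 1
      exact Finset.prod_congr rfl fun ν _ => (hN ν (t ν) (ht ν)).symm
  rw [← integral_integral_swap hI]
  congr 1
  ext t
  rw [integral_const_mul, muPos, integral_fintype_prod_eq_prod (fun ν u => G ν (t ν) u)]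

/-- the additive character `e(-t·ξ)` -/
def EE {r : ℕ} (t ξ : Fin r → ℝ) : ℂ := ∏ ν, eC (-((t ν : ℂ) * (ξ ν : ℂ)))

lemma EE_norm {r : ℕ} (t ξ : Fin r → ℝ) : ‖EE t ξ‖ = 1 := by
  rw [EE, norm_prod]
  refine Finset.prod_eq_one fun ν _ => ?_
  have := norm_eC_real (-(t ν * ξ ν))
  push_cast at this
  exact this

lemma EE_cont {r : ℕ} : Continuous fun q : (Fin r → ℝ) × (Fin r → ℝ) => EE q.1 q.2 := by
  unfold EE eC; fun_prop

lemma parseval {r : ℕ} {H g : (Fin r → ℝ) → ℂ} (hH : Integrable H) (hg : Integrable g) :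
    ∫ t, (∫ ξ, H ξ * EE t ξ) * g t = ∫ ξ, H ξ * ∫ t, g t * EE t ξ := by
  have hI : Integrable (fun q : (Fin r → ℝ) × (Fin r → ℝ) => (g q.1 * H q.2) * EE q.1 q.2)
      (volume.prod volume) :=
    (hg.mul_prod hH).mul_bdd (c := 1) EE_cont.aestronglyMeasurable
      (Filter.Eventually.of_forall fun q => (EE_norm _ _).le)
  have h := integral_integral_swap (f := fun t ξ => (g t * H ξ) * EE t ξ) hI
  calc _ = ∫ t, ∫ ξ, (g t * H ξ) * EE t ξ := by
        congr 1; ext t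
        rw [← integral_mul_const]
        congr 1; ext ξ; ring
    _ = ∫ ξ, ∫ t, (g t * H ξ) * EE t ξ := h
    _ = _ := by
        congr 1; ext ξ
        rw [← integral_const_mul]
        congr 1; ext t; ring

lemma tate {r : ℕ} {ε : Fin r → ℕ} (hε : ∀ ν, ε ν ≤ 1) {s : Fin r → ℂ}
    (hs : ∀ ν, 0 < (s ν).re ∧ (s ν).re < 1) {f H : (Fin r → ℝ) → ℂ}
    (hf : AEStronglyMeasurable f) (hH : Integrable H) (hfH : ∀ t, f t = ∫ ξ, H ξ * EE t ξ)
    (hfi : Integrable fun t : Fin r → ℝ => ‖f t‖ * ∏ ν, |t ν| ^ (-(1 - s ν).re))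
    (hHi : Integrable fun t : Fin r → ℝ => ‖H t‖ * ∏ ν, |t ν| ^ (-(s ν).re)) :
    (∏ ν, GammaR (1 - s ν + ε ν)) *
        ∫ t : Fin r → ℝ, f t * ∏ ν, ((Real.sign (t ν) : ℂ) ^ (ε ν) * ((|t ν| : ℝ) : ℂ) ^ (-(1 - s ν)))
      = (∏ ν, (-Complex.I) ^ (ε ν)) * (∏ ν, GammaR (s ν + ε ν)) *
        ∫ t : Fin r → ℝ, H t * ∏ ν, ((Real.sign (t ν) : ℂ) ^ (ε ν) * ((|t ν| : ℝ) : ℂ) ^ (-(s ν))) := by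
  have hs1 : ∀ ν, 0 < (1 - s ν).re := fun ν => by simpa using (hs ν).2
  have h1 := swap_mellin hf (fun ν => gK (ε ν) (1 - s ν)) (fun ν => gK_meas _ _)
    (fun ν t ht => gK_integrable _ (hs1 ν) ht)
    (fun ν t => ‖GammaR (((1 - s ν).re : ℂ) + ε ν)‖ * |t| ^ (-(1 - s ν).re))
    (fun ν t ht => gK_norm_integral _ (hs1 ν) ht) (by
      refine (hfi.const_mul (∏ ν, ‖GammaR (((1 - s ν).re : ℂ) + ε ν)‖)).congr
        (Filter.Eventually.of_forall fun t => ?_)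
      simp only [Finset.prod_mul_distrib]; ring)
  have h2 := swap_mellin hH.aestronglyMeasurable (fun ν => gH (ε ν) (s ν)) (fun ν => gH_meas _ _)
    (fun ν t ht => gH_integrable _ (hs ν).1 ht)
    (fun ν t => ‖GammaR (((s ν).re : ℂ) + ε ν)‖ * |t| ^ (-(s ν).re))
    (fun ν t ht => gH_norm_integral _ (hs ν).1 ht) (by
      refine (hHi.const_mul (∏ ν, ‖GammaR (((s ν).re : ℂ) + ε ν)‖)).congr
        (Filter.Eventually.of_forall fun t => ?_)
      simp only [Finset.prod_mul_distrib]; ring)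
  have h3 : ∫ u, (∫ t : Fin r → ℝ, f t * ∏ ν, gK (ε ν) (1 - s ν) (t ν) (u ν)) ∂(muPos r) =
      ∫ u, (∫ t : Fin r → ℝ, H t * ∏ ν, gH (ε ν) (s ν) (t ν) (u ν)) ∂(muPos r) := by
    refine integral_congr_ae ?_
    filter_upwards [ae_pos_muPos r] with u hu
    simp_rw [hfH]
    rw [parseval hH (g := fun t => ∏ ν, gK (ε ν) (1 - s ν) (t ν) (u ν))
      (Integrable.fintype_prod (μ := fun _ => volume)
        (fun ν => gK_t_integrable (hε ν) (1 - s ν) (hu ν)))]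
    congr 1
    ext ξ
    congr 1
    simp_rw [EE, ← Finset.prod_mul_distrib]
    rw [integral_fintype_prod_volume_eq_prod
      (fun ν (t : ℝ) => gK (ε ν) (1 - s ν) t (u ν) * eC (-((t : ℂ) * (ξ ν : ℂ))))]
    exact Finset.prod_congr rfl fun ν _ => gK_fourier (hε ν) (s ν) (hu ν) (ξ ν)
  rw [← h1, ← h2] at h3
  rw [← integral_const_mul, ← integral_const_mul]
  refine Eq.trans (integral_congr_ae ?_) (h3.trans (integral_congr_ae ?_))
  · filter_upwards [ae_ne_zero_pi r] with t ht
    rw [Finset.prod_congr rfl fun ν _ => gK_integral (ε ν) (hs1 ν) (ht ν)]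
    simp only [Finset.prod_mul_distrib]
    ring
  · filter_upwards [ae_ne_zero_pi r] with t ht
    rw [Finset.prod_congr rfl fun ν _ => gH_integral (ε ν) (hs ν).1 (ht ν)]
    simp only [Finset.prod_mul_distrib]
    ring

lemma FF_cont {r : ℕ} (A : Matrix (Fin r) (Fin r) ℝ) (x : Fin r → ℝ) {y : Fin r → ℝ}
    (hy : ∀ ν, y ν ∈ Set.Ioo (0 : ℝ) 1) : Continuous fun t => FF (Matrix.vecMul t A) x y := by
  unfold FF
  refine continuous_finsetProd _ fun ν _ => ?_
  refine (phi_cont (x ν) (hy ν)).comp (g := fun t => phiF t (x ν) (y ν)) ?_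
  exact (continuous_apply ν).comp (Continuous.matrix_vecMul continuous_id continuous_const)

lemma FF_bound {r : ℕ} {A : Matrix (Fin r) (Fin r) ℝ} (hA : A.det ≠ 0) {x y : Fin r → ℝ}
    (hx : ∀ ν, x ν ∈ Set.Ioo (0 : ℝ) 1) (hy : ∀ ν, y ν ∈ Set.Ioo (0 : ℝ) 1) :
    ∃ C m : ℝ, 0 < C ∧ 0 < m ∧
      ∀ t, ‖FF (Matrix.vecMul t A) x y‖ ≤ C * ∏ ν, Real.exp (-(m * |t ν|)) := by
  choose C m hC hm hb using fun ν => phi_bound (hx ν) (hy ν)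
  set K : Fin r → ℝ := fun μ => ∑ ν, |A⁻¹ μ ν| with hK
  have hK0 : ∀ μ, 0 ≤ K μ := fun μ => Finset.sum_nonneg fun ν _ => abs_nonneg _
  set S : ℝ := 1 + ∑ μ, K μ / m μ with hS
  have hS0 : 0 < S := by
    have : 0 ≤ ∑ μ, K μ / m μ := Finset.sum_nonneg fun μ _ => div_nonneg (hK0 μ) (hm μ).le
    linarith
  have hKm : ∀ μ, S⁻¹ * K μ ≤ m μ := fun μ => by
    have h1 : K μ / m μ ≤ S := by
      have := Finset.single_le_sum (f := fun μ => K μ / m μ)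
        (fun μ _ => div_nonneg (hK0 μ) (hm μ).le) (Finset.mem_univ μ)
      linarith
    rw [div_le_iff₀ (hm μ)] at h1
    rw [inv_mul_le_iff₀ hS0]
    exact h1
  refine ⟨∏ μ, C μ, S⁻¹, Finset.prod_pos fun μ _ => hC μ, inv_pos.2 hS0, fun t => ?_⟩
  set τ := Matrix.vecMul t A with hτ
  have ht : t = Matrix.vecMul τ A⁻¹ := by
    rw [hτ, Matrix.vecMul_vecMul, Matrix.mul_nonsing_inv _ (isUnit_iff_ne_zero.2 hA),
      Matrix.vecMul_one]
  have hsum : ∑ ν, |t ν| ≤ ∑ μ, |τ μ| * K μ := by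
    calc ∑ ν, |t ν| ≤ ∑ ν, ∑ μ, |τ μ| * |A⁻¹ μ ν| := by
          refine Finset.sum_le_sum fun ν _ => ?_
          have : t ν = ∑ μ, τ μ * A⁻¹ μ ν := by
            conv_lhs => rw [ht]
            rfl
          rw [this]
          refine (Finset.abs_sum_le_sum_abs _ _).trans (le_of_eq ?_)
          simp only [abs_mul]
      _ = _ := by
          rw [Finset.sum_comm]
          simp only [hK, Finset.mul_sum]
  have hfin : ∑ ν, S⁻¹ * |t ν| ≤ ∑ μ, m μ * |τ μ| := by
    rw [← Finset.mul_sum]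
    calc S⁻¹ * ∑ ν, |t ν| ≤ S⁻¹ * ∑ μ, |τ μ| * K μ :=
          mul_le_mul_of_nonneg_left hsum (inv_pos.2 hS0).le
      _ = ∑ μ, (S⁻¹ * K μ) * |τ μ| := by
          rw [Finset.mul_sum]; exact Finset.sum_congr rfl fun μ _ => by ring
      _ ≤ _ := Finset.sum_le_sum fun μ _ => mul_le_mul_of_nonneg_right (hKm μ) (abs_nonneg _)
  rw [FF, norm_prod]
  calc ∏ μ, ‖phiF (τ μ) (x μ) (y μ)‖ ≤ ∏ μ, (C μ * Real.exp (-(m μ * |τ μ|))) :=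
        Finset.prod_le_prod (fun μ _ => norm_nonneg _) fun μ _ => hb μ (τ μ)
    _ = (∏ μ, C μ) * Real.exp (-∑ μ, m μ * |τ μ|) := by
        rw [Finset.prod_mul_distrib, ← Real.exp_sum, Finset.sum_neg_distrib]
    _ ≤ (∏ μ, C μ) * Real.exp (-∑ ν, S⁻¹ * |t ν|) := by
        refine mul_le_mul_of_nonneg_left ?_ (Finset.prod_pos fun μ _ => hC μ).le
        exact Real.exp_le_exp.2 (neg_le_neg hfin)
    _ = _ := by rw [← Real.exp_sum, Finset.sum_neg_distrib]

lemma FF_int {r : ℕ} {A : Matrix (Fin r) (Fin r) ℝ} (hA : A.det ≠ 0) {x y : Fin r → ℝ}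
    (hx : ∀ ν, x ν ∈ Set.Ioo (0 : ℝ) 1) (hy : ∀ ν, y ν ∈ Set.Ioo (0 : ℝ) 1)
    {a : Fin r → ℝ} (ha : ∀ ν, 0 < a ν) :
    Integrable fun t : Fin r → ℝ =>
      ‖FF (Matrix.vecMul t A) x y‖ * ∏ ν, |t ν| ^ (a ν - 1) := by
  obtain ⟨C, m, hC, hm, hb⟩ := FF_bound hA hx hy
  have h := (Integrable.fintype_prod (μ := fun _ => volume)
    (fun ν => integrable_abs_exp hm (ha ν))).const_mul C
  refine Integrable.mono' h ?_ (Filter.Eventually.of_forall fun t => ?_)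
  · refine Measurable.aestronglyMeasurable ?_
    refine ((FF_cont A x hy).norm.measurable).mul ?_
    exact Finset.measurable_fun_prod _ fun ν _ => by fun_prop
  · have hp : 0 ≤ ∏ ν, |t ν| ^ (a ν - 1) :=
      Finset.prod_nonneg fun ν _ => Real.rpow_nonneg (abs_nonneg _) _
    rw [Real.norm_of_nonneg (mul_nonneg (norm_nonneg _) hp)]
    refine (mul_le_mul_of_nonneg_right (hb t) hp).trans (le_of_eq ?_)
    rw [Finset.prod_mul_distrib]; ring

lemma FF_integrable {r : ℕ} {A : Matrix (Fin r) (Fin r) ℝ} (hA : A.det ≠ 0) {x y : Fin r → ℝ}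
    (hx : ∀ ν, x ν ∈ Set.Ioo (0 : ℝ) 1) (hy : ∀ ν, y ν ∈ Set.Ioo (0 : ℝ) 1) :
    Integrable fun t : Fin r → ℝ => FF (Matrix.vecMul t A) x y := by
  have h := FF_int hA hx hy (a := fun _ => 1) (fun _ => one_pos)
  simp only [sub_self, Real.rpow_zero, Finset.prod_const_one, mul_one] at h
  exact (integrable_norm_iff (FF_cont A x hy).aestronglyMeasurable).1 h

lemma integral_vecMul {r : ℕ} {B : Matrix (Fin r) (Fin r) ℝ} (hB : B.det ≠ 0)
    (g : (Fin r → ℝ) → ℂ) (hg : Continuous g) :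
    ∫ t, g (Matrix.vecMul t B) = ((|B.det|⁻¹ : ℝ) : ℂ) * ∫ t, g t := by
  have hB' : B.transpose.det ≠ 0 := by rwa [Matrix.det_transpose]
  have h := Real.map_matrix_volume_pi_eq_smul_volume_pi hB'
  have hc : Continuous (Matrix.toLin' B.transpose) := LinearMap.continuous_of_finiteDimensional _
  have h2 := integral_map (μ := (volume : Measure (Fin r → ℝ)))
    (φ := Matrix.toLin' B.transpose) hc.aemeasurable (f := g) hg.aestronglyMeasurable
  rw [h, integral_smul_measure, Matrix.det_transpose] at h2
  simp only [Matrix.toLin'_apply, Matrix.mulVec_transpose] at h2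
  rw [← h2, ENNReal.toReal_ofReal (abs_nonneg _), abs_inv, Complex.real_smul]

lemma EE_eq {r : ℕ} (a b : Fin r → ℝ) : EE a b = eC (-((a ⬝ᵥ b : ℝ) : ℂ)) := by
  simp only [EE, eC, dotProduct]
  rw [← Complex.exp_sum, ← Finset.mul_sum]
  push_cast
  rw [Finset.sum_neg_distrib]

lemma FF_fourier_one {r : ℕ} {x y : Fin r → ℝ}
    (hx : ∀ ν, x ν ∈ Set.Ioo (0 : ℝ) 1) (hy : ∀ ν, y ν ∈ Set.Ioo (0 : ℝ) 1) (τ : Fin r → ℝ) :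
    FF τ x y = ∫ ζ : Fin r → ℝ, Complex.I ^ r * eC (-((∑ ν, x ν * y ν : ℝ) : ℂ)) *
      FF ζ y (fun ν => 1 - x ν) * EE τ ζ := by
  have he : eC (-((∑ ν, x ν * y ν : ℝ) : ℂ)) = ∏ ν, eC (-((x ν : ℂ) * (y ν : ℂ))) :=
    (EE_eq x y).symm
  have h0 : FF τ x y = ∏ ν, ∫ ξ : ℝ, Complex.I * eC (-((x ν : ℂ) * (y ν : ℂ))) *
      phiF ξ (y ν) (1 - x ν) * eC (-((τ ν : ℂ) * (ξ : ℂ))) :=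
    Finset.prod_congr rfl fun ν _ => phi_fourier (hx ν) (hy ν) (τ ν)
  rw [h0, ← integral_fintype_prod_volume_eq_prod (fun ν (ξ : ℝ) =>
    Complex.I * eC (-((x ν : ℂ) * (y ν : ℂ))) *
      phiF ξ (y ν) (1 - x ν) * eC (-((τ ν : ℂ) * (ξ : ℂ))))]
  refine integral_congr_ae (Filter.Eventually.of_forall fun ζ => ?_)
  simp only [Finset.prod_mul_distrib, FF, EE, he, Finset.prod_const, Finset.card_univ,
      Fintype.card_fin]

lemma FF_fourier {r : ℕ} {A : Matrix (Fin r) (Fin r) ℝ} (hA : A.det ≠ 0) {x y : Fin r → ℝ}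
    (hx : ∀ ν, x ν ∈ Set.Ioo (0 : ℝ) 1) (hy : ∀ ν, y ν ∈ Set.Ioo (0 : ℝ) 1) (t : Fin r → ℝ) :
    FF (Matrix.vecMul t A) x y = ∫ ξ, (Complex.I ^ r * eC (-((∑ ν, x ν * y ν : ℝ) : ℂ)) *
      ((|A.det|⁻¹ : ℝ) : ℂ) * FF (Matrix.vecMul ξ A.transpose⁻¹) y (fun ν => 1 - x ν)) * EE t ξ := by
  have hB : A.transpose⁻¹.det ≠ 0 := by
    rw [Matrix.det_nonsing_inv, Matrix.det_transpose, Ring.inverse_eq_inv']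
    exact inv_ne_zero hA
  have hx' : ∀ ν, (1 - x ν) ∈ Set.Ioo (0 : ℝ) 1 := fun ν =>
    ⟨by linarith [(hx ν).2], by linarith [(hx ν).1]⟩
  obtain ⟨τ, hτ⟩ : ∃ τ, τ = Matrix.vecMul t A := ⟨_, rfl⟩
  rw [← hτ]
  have h1 : FF τ x y = ∫ ζ : Fin r → ℝ, Complex.I ^ r * eC (-((∑ ν, x ν * y ν : ℝ) : ℂ)) *
      FF ζ y (fun ν => 1 - x ν) * EE τ ζ := 
    FF_fourier_one hx hy τ
  have hEE : ∀ ξ, EE τ (Matrix.vecMul ξ A.transpose⁻¹) = EE t ξ := by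
    intro ξ
    have hd : τ ⬝ᵥ (Matrix.vecMul ξ A.transpose⁻¹) = t ⬝ᵥ ξ := by
      rw [← Matrix.mulVec_transpose, Matrix.transpose_nonsing_inv, Matrix.transpose_transpose,
        hτ, Matrix.dotProduct_mulVec, Matrix.vecMul_vecMul,
        Matrix.mul_nonsing_inv _ (isUnit_iff_ne_zero.2 hA), Matrix.vecMul_one]
    rw [EE_eq, EE_eq, hd]
  have hEc : Continuous fun ζ => EE τ ζ :=
    EE_cont.comp (Continuous.prodMk continuous_const continuous_id)
  have hFc : Continuous fun ζ : Fin r → ℝ => FF ζ y (fun ν => 1 - x ν) := by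
    have := FF_cont (1 : Matrix (Fin r) (Fin r) ℝ) y hx'
    simpa using this
  have h2 := integral_vecMul hB (fun ζ => Complex.I ^ r * eC (-((∑ ν, x ν * y ν : ℝ) : ℂ)) *
      FF ζ y (fun ν => 1 - x ν) * EE τ ζ) ((continuous_const.mul hFc).mul hEc)
  rw [← h1] at h2
  have hdet : A.transpose⁻¹.det = A.det⁻¹ := by
    rw [Matrix.det_nonsing_inv, Matrix.det_transpose, Ring.inverse_eq_inv']
  rw [hdet, abs_inv, inv_inv] at h2
  have hd0 : ((|A.det| : ℝ) : ℂ) ≠ 0 := by exact_mod_cast abs_ne_zero.2 hA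
  have h3 : FF τ x y = ((|A.det|⁻¹ : ℝ) : ℂ) * (((|A.det| : ℝ) : ℂ) * FF τ x y) := by
    push_cast
    rw [inv_mul_cancel_left₀ hd0]
  rw [← h2, ← integral_const_mul] at h3
  refine h3.trans (integral_congr_ae (Filter.Eventually.of_forall fun ξ => ?_))
  simp only [hEE]
  ring

lemma kernel_eq {c : ℕ} (hc : c ≤ 1) {s : ℂ} (hs : s.re < 1) (t : ℝ) :
    ((Real.sign t : ℂ)) ^ c * ((|t| : ℝ) : ℂ) ^ s * ((t : ℝ) : ℂ)⁻¹ =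
      (Real.sign t : ℂ) ^ (1 - c) * ((|t| : ℝ) : ℂ) ^ (-(1 - s)) := by
  by_cases ht : t = 0
  · subst ht
    have : -(1 - s) ≠ 0 := fun h => by
      have := congrArg Complex.re h
      simp at this
      linarith
    rw [abs_zero, Complex.ofReal_zero, Complex.zero_cpow this]
    simp
  have ha : ((|t| : ℝ) : ℂ) ≠ 0 := by exact_mod_cast abs_ne_zero.2 ht
  have h1 : ((|t| : ℝ) : ℂ) ^ (-(1 - s)) = ((|t| : ℝ) : ℂ) ^ s * ((|t| : ℝ) : ℂ)⁻¹ := by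
    rw [show -(1 - s) = s - 1 by ring, Complex.cpow_sub _ _ ha, Complex.cpow_one, div_eq_mul_inv]
  rw [h1]
  rcases lt_or_gt_of_ne ht with h | h
  · rw [Real.sign_of_neg h, abs_of_neg h]
    interval_cases c <;> simp
  · rw [Real.sign_of_pos h, abs_of_pos h]
    interval_cases c <;> simp

lemma gamma_eq {c : ℕ} (hc : c ≤ 1) {s : ℂ} (hs : 0 < s.re) :
    GammaR (s + c) * (GammaC s)⁻¹ = (GammaR (s + (1 - c : ℕ)))⁻¹ := by
  have h := Complex.Gammaℝ_mul_Gammaℝ_add_one s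
  have e1 : Complex.Gammaℝ = GammaR := by ext s; rfl
  have e2 : Complex.Gammaℂ = GammaC := by ext s; rfl
  have n1 := Complex.Gammaℝ_ne_zero_of_re_pos hs
  have n2 : Complex.Gammaℝ (s + 1) ≠ 0 := Complex.Gammaℝ_ne_zero_of_re_pos (by simp; linarith)
  rw [e1] at n1 n2
  rw [e1, e2] at h
  rw [← h]
  interval_cases c
  · simp only [Nat.cast_zero, add_zero, Nat.sub_zero, Nat.cast_one]
    field_simp
  · simp only [Nat.cast_zero, add_zero, Nat.sub_self, Nat.cast_one]
    field_simp

lemma Lhat_eq {r : ℕ} {χ : Fin r → ℕ} (hχ : ∀ ν, χ ν ≤ 1) (A : Matrix (Fin r) (Fin r) ℝ)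
    (x y : Fin r → ℝ) {s : Fin r → ℂ} (hs : ∀ ν, 0 < (s ν).re ∧ (s ν).re < 1) :
    ShintaniLhat χ s A x y = ((Real.sqrt |A.det| : ℝ) : ℂ) *
      (∏ ν, GammaR (s ν + (1 - χ ν : ℕ)))⁻¹ * ∫ t : Fin r → ℝ, FF (Matrix.vecMul t A) x y *
        ∏ ν, ((Real.sign (t ν) : ℂ) ^ (1 - χ ν) * ((|t ν| : ℝ) : ℂ) ^ (-(1 - s ν))) := by
  have hI : ∀ t : Fin r → ℝ, FF (Matrix.vecMul t A) x y * qchar χ s t * ∏ ν, ((t ν : ℝ) : ℂ)⁻¹ =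
      FF (Matrix.vecMul t A) x y *
        ∏ ν, ((Real.sign (t ν) : ℂ) ^ (1 - χ ν) * ((|t ν| : ℝ) : ℂ) ^ (-(1 - s ν))) := by
    intro t
    rw [mul_assoc, qchar, ← Finset.prod_mul_distrib]
    congr 1
    exact Finset.prod_congr rfl fun ν _ => kernel_eq (hχ ν) (hs ν).2 (t ν)
  have hG : GammaChi χ s * (∏ ν, GammaC (s ν))⁻¹ = (∏ ν, GammaR (s ν + (1 - χ ν : ℕ)))⁻¹ := by
    rw [GammaChi, ← Finset.prod_inv_distrib, ← Finset.prod_inv_distrib, ← Finset.prod_mul_distrib]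
    exact Finset.prod_congr rfl fun ν _ => gamma_eq (hχ ν) (hs ν).1
  rw [ShintaniLhat, ShintaniLchi, ← hG]
  simp_rw [hI]
  ring

theorem stmt_4 (r : ℕ) (hr : 1 ≤ r) (χ : Fin r → ℕ) (hχ : ∀ ν, χ ν ≤ 1)
    (A : Matrix (Fin r) (Fin r) ℝ) (hA : A.det ≠ 0) (x y : Fin r → ℝ)
    (hx : ∀ ν, x ν ∈ Set.Ioo (0 : ℝ) 1) (hy : ∀ ν, y ν ∈ Set.Ioo (0 : ℝ) 1)
    (s : Fin r → ℂ) (hs : ∀ ν, 0 < (s ν).re ∧ (s ν).re < 1) :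
    ShintaniLhat χ s A x y =
      Complex.I ^ (∑ ν, χ ν) * eC (-((∑ ν, x ν * y ν : ℝ) : ℂ)) *
        ShintaniLhat χ (fun ν => 1 - s ν) A.transpose⁻¹ y (fun ν => 1 - x ν) := by
  have hs' : ∀ ν, 0 < (1 - s ν).re ∧ (1 - s ν).re < 1 := fun ν => by
    simpa using (hs ν).symm
  have hx' : ∀ ν, (1 - x ν) ∈ Set.Ioo (0 : ℝ) 1 := fun ν =>
    ⟨by linarith [(hx ν).2], by linarith [(hx ν).1]⟩
  have hdet : A.transpose⁻¹.det = A.det⁻¹ := by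
    rw [Matrix.det_nonsing_inv, Matrix.det_transpose, Ring.inverse_eq_inv']
  have hB : A.transpose⁻¹.det ≠ 0 := by rw [hdet]; exact inv_ne_zero hA
  have hε : ∀ ν, 1 - χ ν ≤ 1 := fun ν => Nat.sub_le _ _
  set c : ℂ := Complex.I ^ r * eC (-((∑ ν, x ν * y ν : ℝ) : ℂ)) * ((|A.det|⁻¹ : ℝ) : ℂ) with hc
  have hfi : Integrable fun t : Fin r → ℝ =>
      ‖FF (Matrix.vecMul t A) x y‖ * ∏ ν, |t ν| ^ (-(1 - s ν).re) := by
    have := FF_int hA hx hy (a := fun ν => (s ν).re) (fun ν => (hs ν).1)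
    simpa using this
  have hHi : Integrable fun t : Fin r → ℝ =>
      ‖c * FF (Matrix.vecMul t A.transpose⁻¹) y (fun ν => 1 - x ν)‖ * ∏ ν, |t ν| ^ (-(s ν).re) := by
    have := (FF_int hB hy hx' (a := fun ν => (1 - s ν).re) (fun ν => (hs' ν).1)).const_mul ‖c‖
    refine this.congr (Filter.Eventually.of_forall fun t => ?_)
    simp [mul_assoc]
  have hT := tate hε hs (FF_cont A x hy).aestronglyMeasurable
    ((FF_integrable hB hy hx').const_mul c) (FF_fourier hA hx hy) hfi hHi
  rw [Lhat_eq hχ A x y hs, Lhat_eq hχ _ _ _ hs', hdet]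
  simp only [sub_sub_cancel]
  simp only [mul_assoc c] at hT
  rw [integral_const_mul] at hT
  set Z1 := ∫ t : Fin r → ℝ, FF (Matrix.vecMul t A) x y *
    ∏ ν, ((Real.sign (t ν) : ℂ) ^ (1 - χ ν) * ((|t ν| : ℝ) : ℂ) ^ (-(1 - s ν)))
  set Z2 := ∫ t : Fin r → ℝ, FF (Matrix.vecMul t A.transpose⁻¹) y (fun ν => 1 - x ν) *
    ∏ ν, ((Real.sign (t ν) : ℂ) ^ (1 - χ ν) * ((|t ν| : ℝ) : ℂ) ^ (-(s ν)))
  have hg : ∀ z : Fin r → ℂ, (∀ ν, 0 < (z ν).re) → ∏ ν, GammaR (z ν + (1 - χ ν : ℕ)) ≠ 0 := by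
    intro z hz
    refine Finset.prod_ne_zero_iff.2 fun ν _ => ?_
    refine Complex.Gammaℝ_ne_zero_of_re_pos ?_
    have : (0 : ℝ) ≤ ((1 - χ ν : ℕ) : ℝ) := Nat.cast_nonneg _
    simp only [Complex.add_re, Complex.natCast_re]
    linarith [hz ν]
  have g1 := hg s fun ν => (hs ν).1
  have g2 := hg (fun ν => 1 - s ν) fun ν => (hs' ν).1
  have hI : (∏ ν, (-Complex.I) ^ (1 - χ ν)) * Complex.I ^ r = Complex.I ^ (∑ ν, χ ν) := by
    have : Complex.I ^ r = ∏ _ν : Fin r, Complex.I := by simp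
    rw [this, ← Finset.prod_mul_distrib, ← Finset.prod_pow_eq_pow_sum]
    refine Finset.prod_congr rfl fun ν _ => ?_
    have := hχ ν
    interval_cases χ ν <;> simp
  have hsq : ((Real.sqrt |A.det| : ℝ) : ℂ) * ((|A.det|⁻¹ : ℝ) : ℂ) =
      ((Real.sqrt |A.det⁻¹| : ℝ) : ℂ) := by
    rw [← Complex.ofReal_mul]
    congr 1
    have hd : 0 < |A.det| := abs_pos.2 hA
    rw [abs_inv, Real.sqrt_inv]
    have h1 := Real.mul_self_sqrt hd.le
    have h2 := Real.sqrt_pos.2 hd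
    nth_rewrite 2 [← h1]
    field_simp
  rw [← hI, ← hsq]
  set G1 := ∏ ν, GammaR (s ν + (1 - χ ν : ℕ))
  set G2 := ∏ ν, GammaR (1 - s ν + (1 - χ ν : ℕ))
  have hZ : Z1 = G2⁻¹ * ((∏ ν, (-Complex.I) ^ (1 - χ ν)) * G1 * (c * Z2)) := by
    rw [← hT, inv_mul_cancel_left₀ g2]
  rw [hZ, hc]
  field_simp

end
end

section
/- Let x, y ∈ (0,1) and h ∈ ℝ. Then ∫_ℝ (e(iux)/(1 − e(y+iu))) · e(uh) du = i · e(−yx) · e(ihy)/(1 − e((1−x) + ih)); that is, ∫_ℝ φ(u,x,y) e(uh) du = i e(−yx) φ(h, y, 1−x). -/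
open MeasureTheory

noncomputable section

/-- the integrand, as a function of a complex variable -/
def fC (x y h : ℝ) (z : ℂ) : ℂ :=
  eC (Complex.I * z * x) * eC (z * h) / (1 - eC (y + Complex.I * z))

lemma eC_add (a b : ℂ) : eC (a + b) = eC a * eC b := by
  simp only [eC, mul_add, Complex.exp_add]

lemma eC_one : eC 1 = 1 := by
  simp [eC, Complex.exp_two_pi_mul_I]

lemma eC_zero : eC 0 = 1 := by simp [eC]

lemma norm_eC (z : ℂ) : ‖eC z‖ = Real.exp (-(2 * Real.pi * z.im)) := by
  simp [eC, Complex.norm_exp]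

lemma eC_eq_one {z : ℂ} (hz : eC z = 1) : ∃ n : ℤ, z = n := by
  rw [eC, Complex.exp_eq_one_iff] at hz
  obtain ⟨n, hn⟩ := hz
  refine ⟨n, ?_⟩
  have h2 : (2 * Real.pi * Complex.I : ℂ) ≠ 0 := Complex.two_pi_I_ne_zero
  apply mul_left_cancel₀ h2
  rw [hn]; ring

lemma differentiable_eC : Differentiable ℂ eC := by
  unfold eC; fun_prop

lemma hasDerivAt_eC (z : ℂ) : HasDerivAt eC (2 * Real.pi * Complex.I * eC z) z := by
  have h1 : HasDerivAt (fun z : ℂ => 2 * Real.pi * Complex.I * z) (2 * Real.pi * Complex.I) z := by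
    simpa using (hasDerivAt_id z).const_mul (2 * Real.pi * Complex.I : ℂ)
  exact h1.cexp.congr_deriv (by unfold eC; ring)

/-- zeros of the denominator in the strip -/
lemma den_zero {y : ℝ} {z : ℂ} (h1 : y - 1 < z.im) (h2 : z.im < y + 1)
    (h0 : 1 - eC (y + Complex.I * z) = 0) : z = y * Complex.I := by
  obtain ⟨n, hn⟩ := eC_eq_one (sub_eq_zero.mp h0).symm
  have hre := congrArg Complex.re hn
  have him := congrArg Complex.im hn
  simp at hre him
  have hn1 : (n : ℝ) < 1 := by linarith
  have hn2 : (-1 : ℝ) < n := by linarith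
  have hn3 : n < 1 := by exact_mod_cast hn1
  have hn4 : -1 < n := by exact_mod_cast hn2
  have hn0 : n = 0 := by omega
  subst hn0
  apply Complex.ext
  · simpa using him
  · simp at hre ⊢; linarith

lemma fC_eq (x y h : ℝ) : ∃ g : ℂ → ℂ,
    DifferentiableOn ℂ g {z : ℂ | y - 1 < z.im ∧ z.im < y + 1} ∧
    ∀ z : ℂ, y - 1 < z.im → z.im < y + 1 → z ≠ y * Complex.I →
      g z = fC x y h z - eC (-((y * x : ℝ) : ℂ)) * eC (Complex.I * h * y) / (2 * Real.pi) *
        (z - y * Complex.I)⁻¹ := by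
  set c : ℂ := y * Complex.I with hc
  set S : Set ℂ := {z : ℂ | y - 1 < z.im ∧ z.im < y + 1} with hS
  have hSo : IsOpen S := (isOpen_lt continuous_const Complex.continuous_im).inter
    (isOpen_lt Complex.continuous_im continuous_const)
  have hcS : c ∈ S := by simp [hS, hc]
  have hSn : S ∈ nhds c := hSo.mem_nhds hcS
  set D : ℂ → ℂ := fun z => 1 - eC (y + Complex.I * z) with hD
  have hdD : Differentiable ℂ D := by
    have := differentiable_eC
    fun_prop
  have hDc : D c = 0 := by
    have : (y : ℂ) + Complex.I * (y * Complex.I) = 0 := by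
      linear_combination (y : ℂ) * Complex.I_mul_I
    simp [hD, hc, this, eC_zero]
  have hD' : deriv D c = 2 * Real.pi := by
    have h0 : HasDerivAt (fun z : ℂ => (y : ℂ) + Complex.I * z) Complex.I c := by
      simpa using ((hasDerivAt_id c).const_mul Complex.I).const_add (y : ℂ)
    have h1 := ((hasDerivAt_eC (y + Complex.I * c)).comp c h0).const_sub 1
    have h2 : eC (y + Complex.I * c) = 1 := (sub_eq_zero.mp hDc).symm
    have h3 := h1.deriv
    rw [h2] at h3
    have h4 : D = fun x => 1 - (eC ∘ fun z => ↑y + Complex.I * z) x := rfl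
    rw [h4, h3]
    linear_combination (-2 * Real.pi : ℂ) * Complex.I_mul_I
  set q := dslope D c with hq
  have hqd : DifferentiableOn ℂ q S := (Complex.differentiableOn_dslope hSn).2 hdD.differentiableOn
  have hDq : ∀ z, D z = (z - c) * q z := by
    intro z
    have := sub_smul_dslope D c z
    rw [hDc, sub_zero, smul_eq_mul] at this
    exact this.symm
  have hqc : q c = 2 * Real.pi := by rw [hq, dslope_same, hD']
  have hq0 : ∀ z ∈ S, q z ≠ 0 := by
    intro z hz h0
    have h1 : D z = 0 := by rw [hDq, h0, mul_zero]
    have h2 : z = c := den_zero hz.1 hz.2 h1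
    rw [h2, hqc] at h0
    simp [Real.pi_ne_zero] at h0
  set N : ℂ → ℂ := fun z => eC (Complex.I * z * x) * eC (z * h) with hN
  have hNd : Differentiable ℂ N := by
    have := differentiable_eC
    fun_prop
  set P : ℂ → ℂ := fun z => N z / q z with hP
  have hPd : DifferentiableOn ℂ P S := hNd.differentiableOn.div hqd hq0
  have hPc : P c = eC (-((y * x : ℝ) : ℂ)) * eC (Complex.I * h * y) / (2 * Real.pi) := by
    have a1 : Complex.I * c * x = -((y * x : ℝ) : ℂ) := by
      rw [hc]; push_cast; linear_combination (y * x : ℂ) * Complex.I_mul_I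
    have a2 : c * h = Complex.I * h * y := by rw [hc]; ring
    simp only [hP, hN, hqc, a1, a2]
  refine ⟨dslope P c, (Complex.differentiableOn_dslope hSn).2 hPd, ?_⟩
  intro z hz1 hz2 hzc
  have hzc' : z - c ≠ 0 := sub_ne_zero.2 hzc
  have h1 := sub_smul_dslope P c z
  rw [smul_eq_mul] at h1
  rw [← hPc]
  have h2 : fC x y h z = P z / (z - c) := by
    have h3 : fC x y h z = N z / D z := rfl
    rw [h3, hDq, hP]
    field_simp
  rw [h2]
  field_simp
  linear_combination h1

lemma int_inv (a : ℝ) (ha : a ≠ 0) (R : ℝ) :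
    ∫ t in (-R)..R, ((t : ℂ) - a * Complex.I)⁻¹ = 2 * Complex.I * (Real.arctan (R / a) : ℝ) := by
  have hne : ∀ t : ℝ, (t : ℂ) - a * Complex.I ≠ 0 := by
    intro t h0
    have := congrArg Complex.im h0
    simp at this
    exact ha this
  have hpos : ∀ t : ℝ, 0 < t ^ 2 + a ^ 2 := fun t => by positivity
  have hd : ∀ t : ℝ, HasDerivAt (fun t : ℝ => ((1 / 2 * Real.log (t ^ 2 + a ^ 2) : ℝ) : ℂ)
      + Complex.I * ((Real.arctan (t / a) : ℝ) : ℂ)) (((t : ℂ) - a * Complex.I)⁻¹) t := by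
    intro t
    have h1 : HasDerivAt (fun t : ℝ => 1 / 2 * Real.log (t ^ 2 + a ^ 2)) (t / (t ^ 2 + a ^ 2)) t := by
      have := ((((hasDerivAt_id t).pow 2).add_const (a ^ 2)).log (hpos t).ne').const_mul (1 / 2)
      refine this.congr_deriv ?_
      have := (hpos t).ne'
      simp only [id, Pi.pow_apply]
      push_cast
      field_simp
    have h2 : HasDerivAt (fun t : ℝ => Real.arctan (t / a)) (a / (t ^ 2 + a ^ 2)) t := by
      have := ((hasDerivAt_id t).div_const a).arctan
      refine this.congr_deriv ?_
      have := (hpos t).ne'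
      simp only [id]
      field_simp
      ring
    have h3 := h1.ofReal_comp.add (h2.ofReal_comp.const_mul Complex.I)
    refine h3.congr_deriv ?_
    have hp : ((t : ℂ) ^ 2 + (a : ℂ) ^ 2) ≠ 0 := by exact_mod_cast (hpos t).ne'
    have := hne t
    refine eq_inv_of_mul_eq_one_left ?_
    push_cast
    field_simp
    linear_combination -(a : ℂ) ^ 2 * Complex.I_mul_I
  rw [intervalIntegral.integral_eq_sub_of_hasDerivAt (fun t _ => hd t)]
  · rw [neg_div, Real.arctan_neg]
    simp
    ring
  · apply Continuous.intervalIntegrable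
    exact Continuous.inv₀ (by fun_prop) hne

lemma lim_inv_pos (a : ℝ) (ha : 0 < a) :
    Filter.Tendsto (fun R : ℝ => ∫ t in (-R)..R, ((t : ℂ) - a * Complex.I)⁻¹) Filter.atTop
      (nhds (Real.pi * Complex.I)) := by
  simp_rw [int_inv a ha.ne']
  have h1 : Filter.Tendsto (fun R : ℝ => Real.arctan (R / a)) Filter.atTop (nhds (Real.pi / 2)) :=
    (Real.tendsto_arctan_atTop.mono_right nhdsWithin_le_nhds).comp
      (Filter.tendsto_id.atTop_div_const ha)
  have h2 := ((Complex.continuous_ofReal.tendsto _).comp h1).const_mul (2 * Complex.I)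
  have h3 : (2 * Complex.I * ((Real.pi / 2 : ℝ) : ℂ)) = Real.pi * Complex.I := by
    push_cast; ring
  rw [h3] at h2
  exact h2

lemma lim_inv_neg (a : ℝ) (ha : 0 < a) :
    Filter.Tendsto (fun R : ℝ => ∫ t in (-R)..R, ((t : ℂ) - (-a : ℝ) * Complex.I)⁻¹) Filter.atTop
      (nhds (-(Real.pi * Complex.I))) := by
  have h := (lim_inv_pos a ha).neg
  refine h.congr fun R => ?_
  rw [int_inv a ha.ne', int_inv (-a) (neg_ne_zero.2 ha.ne'), div_neg, Real.arctan_neg]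
  push_cast; ring

/-- norm bounds for the integrand -/
lemma fC_bound (x y h : ℝ) (hx : x ∈ Set.Ioo (0 : ℝ) 1) (u v : ℝ) (hv : v ∈ Set.Icc (0 : ℝ) 1)
    (hu : 1 ≤ |u|) :
    ‖fC x y h (u + v * Complex.I)‖ ≤
      2 * Real.exp (2 * Real.pi * |h|) * Real.exp (-(2 * Real.pi * min x (1 - x)) * |u|) := by
  have hpi := Real.pi_gt_three
  have hh : -(v * h) ≤ |h| := by
    have := neg_abs_le h
    nlinarith [abs_nonneg h, hv.1, hv.2, mul_nonneg hv.1 (by linarith : 0 ≤ h + |h|)]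
  have hN1 : ‖eC (Complex.I * (u + v * Complex.I) * x)‖ = Real.exp (-(2 * Real.pi * (u * x))) := by
    rw [norm_eC]; simp
  have hN2 : ‖eC ((u + v * Complex.I) * h)‖ ≤ Real.exp (2 * Real.pi * |h|) := by
    rw [norm_eC]; simp
    nlinarith
  have hD : ‖eC (y + Complex.I * (u + v * Complex.I))‖ = Real.exp (-(2 * Real.pi * u)) := by
    rw [norm_eC]; simp
  set E := eC (y + Complex.I * (u + v * Complex.I)) with hE
  have hm1 : min x (1 - x) ≤ x := min_le_left _ _
  have hm2 : min x (1 - x) ≤ 1 - x := min_le_right _ _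
  have key : Real.exp (-(2 * Real.pi * (u * x))) ≤
      2 * Real.exp (-(2 * Real.pi * min x (1 - x)) * |u|) * ‖1 - E‖ := by
    rcases le_or_gt 0 u with h0 | h0
    · rw [abs_of_nonneg h0] at hu ⊢
      have h1 : Real.exp (-(2 * Real.pi * u)) ≤ 1 / 2 := by
        rw [Real.exp_neg, one_div]
        apply inv_anti₀ (by norm_num)
        have := Real.add_one_le_exp (2 * Real.pi * u)
        nlinarith
      have h2 : 1 / 2 ≤ ‖1 - E‖ := by
        have := norm_sub_norm_le (1 : ℂ) E
        rw [norm_one, hD] at this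
        linarith
      have h3 : Real.exp (-(2 * Real.pi * (u * x))) ≤
          Real.exp (-(2 * Real.pi * min x (1 - x)) * u) := by
        apply Real.exp_le_exp.2
        have := mul_le_mul_of_nonneg_left hm1 (by positivity : 0 ≤ 2 * Real.pi * u)
        linarith
      nlinarith [Real.exp_pos (-(2 * Real.pi * min x (1 - x)) * u)]
    · rw [abs_of_neg h0] at hu ⊢
      have h1 : 2 ≤ Real.exp (-(2 * Real.pi * u)) := by
        have := Real.add_one_le_exp (-(2 * Real.pi * u))
        nlinarith
      have h2 : Real.exp (-(2 * Real.pi * u)) / 2 ≤ ‖1 - E‖ := by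
        have := norm_sub_norm_le E (1 : ℂ)
        rw [norm_one, hD, norm_sub_rev] at this
        linarith
      have h3 : Real.exp (-(2 * Real.pi * (u * x))) ≤
          Real.exp (-(2 * Real.pi * min x (1 - x)) * -u) * Real.exp (-(2 * Real.pi * u)) := by
        rw [← Real.exp_add]
        apply Real.exp_le_exp.2
        have := mul_le_mul_of_nonneg_left hm2 (by nlinarith : 0 ≤ 2 * Real.pi * -u)
        linarith
      nlinarith [Real.exp_pos (-(2 * Real.pi * min x (1 - x)) * -u)]
  have hpos : 0 < ‖1 - E‖ := by
    by_contra hcon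
    have h0 : ‖1 - E‖ = 0 := le_antisymm (not_lt.1 hcon) (norm_nonneg _)
    rw [h0, mul_zero] at key
    exact absurd key (not_le.2 (Real.exp_pos _))
  unfold fC
  rw [norm_div, norm_mul, hN1, div_le_iff₀ hpos]
  calc _ ≤ (2 * Real.exp (-(2 * Real.pi * min x (1 - x)) * |u|) * ‖1 - E‖) *
        Real.exp (2 * Real.pi * |h|) := by gcongr
    _ = _ := by ring

lemma fC_continuous (x y h : ℝ) (hy : y ∈ Set.Ioo (0 : ℝ) 1) :
    Continuous (fun u : ℝ => fC x y h u) := by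
  have he := differentiable_eC.continuous
  unfold fC
  apply Continuous.div
  · fun_prop
  · fun_prop
  · intro u h0
    have := den_zero (y := y) (z := (u : ℂ)) (by simpa using hy.2) (by simp; linarith [hy.1]) h0
    have := congrArg Complex.im this
    simp at this
    linarith [hy.1]

lemma fC_integrable (x y h : ℝ) (hx : x ∈ Set.Ioo (0 : ℝ) 1) (hy : y ∈ Set.Ioo (0 : ℝ) 1) :
    Integrable (fun u : ℝ => fC x y h u) := by
  have hc := fC_continuous x y h hy
  have hb : 0 < 2 * Real.pi * min x (1 - x) := by
    have : 0 < min x (1 - x) := lt_min hx.1 (by linarith [hx.2])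
    have := Real.pi_pos
    positivity
  have hbd : ∀ u : ℝ, 1 ≤ |u| → ‖fC x y h u‖ ≤
      2 * Real.exp (2 * Real.pi * |h|) * Real.exp (-(2 * Real.pi * min x (1 - x)) * |u|) := by
    intro u hu
    simpa using fC_bound x y h hx u 0 (by simp) hu
  set b := 2 * Real.pi * min x (1 - x) with hbdef
  set C := 2 * Real.exp (2 * Real.pi * |h|) with hC
  have hexp := (exp_neg_integrableOn_Ioi 1 hb).const_mul C
  have hpos : ∀ f : ℝ → ℂ, Continuous f → (∀ u : ℝ, 1 ≤ u → ‖f u‖ ≤ C * Real.exp (-b * u)) →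
      IntegrableOn f (Set.Ioi 1) := by
    intro f hf hfb
    refine Integrable.mono' hexp hf.aestronglyMeasurable ?_
    filter_upwards [ae_restrict_mem measurableSet_Ioi] with u hu
    exact hfb u (le_of_lt hu)
  have h1 : IntegrableOn (fun u : ℝ => fC x y h u) (Set.Ioi 1) := by
    apply hpos _ hc
    intro u hu
    have := hbd u (by rwa [abs_of_nonneg (by linarith)])
    rwa [abs_of_nonneg (by linarith)] at this
  have h2 : IntegrableOn (fun u : ℝ => fC x y h u) (Set.Iio (-1)) := by
    have h3 : IntegrableOn (fun u : ℝ => fC x y h ((-u : ℝ) : ℂ)) (Set.Ioi 1) := by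
      apply hpos _ (hc.comp continuous_neg)
      intro u hu
      have := hbd (-u) (by rwa [abs_neg, abs_of_nonneg (by linarith)])
      rwa [abs_neg, abs_of_nonneg (by linarith)] at this
    have := h3.comp_neg
    simpa using this
  have h4 : IntegrableOn (fun u : ℝ => fC x y h u) (Set.Icc (-1) 1) :=
    hc.continuousOn.integrableOn_Icc
  rw [← integrableOn_univ]
  refine ((h2.union h4).union h1).mono_set ?_
  intro u _
  simp only [Set.mem_union, Set.mem_Iio, Set.mem_Icc, Set.mem_Ioi]
  by_cases ha : u < -1
  · simp [ha]
  · by_cases hb : 1 < u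
    · simp [hb]
    · left; right; constructor <;> linarith

lemma fC_shift (x y h : ℝ) (z : ℂ) :
    fC x y h (z + Complex.I) = eC (((1 - x : ℝ) : ℂ) + Complex.I * h) * fC x y h z := by
  have h1 : eC (Complex.I * (z + Complex.I) * x) * eC ((z + Complex.I) * h) =
      eC (((1 - x : ℝ) : ℂ) + Complex.I * h) * (eC (Complex.I * z * x) * eC (z * h)) := by
    rw [← eC_add, ← eC_add, ← eC_add]
    rw [← one_mul (eC _), ← eC_one, ← eC_add]
    congr 1
    push_cast
    linear_combination (x : ℂ) * Complex.I_mul_I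
  have h2 : eC (y + Complex.I * (z + Complex.I)) = eC (y + Complex.I * z) := by
    rw [← one_mul (eC (y + Complex.I * (z + Complex.I))), ← eC_one, ← eC_add]
    congr 1
    linear_combination Complex.I_mul_I
  unfold fC
  rw [h1, h2, mul_div_assoc]

lemma vert_bound (x y h : ℝ) (hx : x ∈ Set.Ioo (0 : ℝ) 1) (hy : y ∈ Set.Ioo (0 : ℝ) 1) (r : ℂ)
    (g : ℂ → ℂ) (hg : ∀ z : ℂ, y - 1 < z.im → z.im < y + 1 → z ≠ y * Complex.I →
      g z = fC x y h z - r * (z - y * Complex.I)⁻¹) (u : ℝ) (hu : 1 ≤ |u|) :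
    ‖∫ v in (0 : ℝ)..1, g (u + v * Complex.I)‖ ≤
      2 * Real.exp (2 * Real.pi * |h|) * Real.exp (-(2 * Real.pi * min x (1 - x)) * |u|)
        + ‖r‖ * |u|⁻¹ := by
  have := intervalIntegral.norm_integral_le_of_norm_le_const (a := (0 : ℝ)) (b := 1)
    (f := fun v : ℝ => g (u + v * Complex.I))
    (C := 2 * Real.exp (2 * Real.pi * |h|) * Real.exp (-(2 * Real.pi * min x (1 - x)) * |u|)
        + ‖r‖ * |u|⁻¹) ?_
  · simpa using this
  intro v hv
  rw [Set.uIoc_of_le zero_le_one] at hv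
  have hu0 : 0 < |u| := by linarith
  have hle : |u| ≤ ‖(u : ℂ) + v * Complex.I - y * Complex.I‖ := by
    have := Complex.abs_re_le_norm ((u : ℂ) + v * Complex.I - y * Complex.I)
    simpa using this
  rw [hg _ (by simp; linarith [hv.1, hy.2]) (by simp; linarith [hv.2, hy.1])]
  · refine (norm_sub_le _ _).trans (add_le_add (fC_bound x y h hx u v ⟨hv.1.le, hv.2⟩ hu) ?_)
    rw [norm_mul, norm_inv]
    gcongr
  · intro h0
    rw [h0, sub_self, norm_zero] at hle
    linarith

lemma bound_lim (C b r : ℝ) (hb : 0 < b) :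
    Filter.Tendsto (fun R : ℝ => C * Real.exp (-b * |R|) + r * |R|⁻¹) Filter.atTop (nhds 0) := by
  have h1 : Filter.Tendsto (fun R : ℝ => |R|) Filter.atTop Filter.atTop :=
    Filter.tendsto_abs_atTop_atTop
  have h2 : Filter.Tendsto (fun R : ℝ => Real.exp (-b * |R|)) Filter.atTop (nhds 0) := by
    apply Real.tendsto_exp_atBot.comp
    exact h1.const_mul_atTop_of_neg (by linarith)
  have h3 := (h2.const_mul C).add ((tendsto_inv_atTop_zero.comp h1).const_mul r)
  simpa using h3

lemma main_id (x y h : ℝ) (hx : x ∈ Set.Ioo (0 : ℝ) 1) (hy : y ∈ Set.Ioo (0 : ℝ) 1) :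
    (1 - eC (((1 - x : ℝ) : ℂ) + Complex.I * h)) * ∫ u : ℝ, fC x y h u =
      Complex.I * (eC (-((y * x : ℝ) : ℂ)) * eC (Complex.I * h * y)) := by
  obtain ⟨g, hgd, hg⟩ := fC_eq x y h
  set r : ℂ := eC (-((y * x : ℝ) : ℂ)) * eC (Complex.I * h * y) / (2 * Real.pi) with hr
  set L := eC (((1 - x : ℝ) : ℂ) + Complex.I * h) with hL
  have hcf := fC_continuous x y h hy
  have hI : ∀ a : ℝ, a ≠ 0 → Continuous (fun t : ℝ => ((t : ℂ) - a * Complex.I)⁻¹) := by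
    intro a ha
    refine Continuous.inv₀ (by fun_prop) ?_
    intro t h0
    have := congrArg Complex.im h0
    simp at this
    exact ha this
  have hy0 : 0 < y := hy.1
  have hy1 : 0 < 1 - y := by linarith [hy.2]
  have hrect : ∀ R : ℝ, 1 ≤ R →
      (1 - L) * (∫ t in (-R)..R, fC x y h t)
        - r * ((∫ t in (-R)..R, ((t : ℂ) - y * Complex.I)⁻¹)
          - ∫ t in (-R)..R, ((t : ℂ) - (-(1 - y) : ℝ) * Complex.I)⁻¹)
      = Complex.I * (∫ v in (0 : ℝ)..1, g ((-R : ℝ) + v * Complex.I))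
        - Complex.I * (∫ v in (0 : ℝ)..1, g (R + v * Complex.I)) := by
    intro R hR
    have h1 := Complex.integral_boundary_rect_eq_zero_of_differentiableOn g
      ((-R : ℝ) : ℂ) ((R : ℂ) + Complex.I) (hgd.mono ?_)
    · have e1 : ∀ t : ℝ, g (t + (0 : ℝ) * Complex.I) =
          fC x y h t - r * ((t : ℂ) - y * Complex.I)⁻¹ := by
        intro t
        rw [hg _ (by simp; linarith) (by simp; linarith)]
        · simp
        · intro h0
          have := congrArg Complex.im h0
          simp at this
          linarith
      have e2 : ∀ t : ℝ, g (t + (1 : ℝ) * Complex.I) =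
          L * fC x y h t - r * ((t : ℂ) - (-(1 - y) : ℝ) * Complex.I)⁻¹ := by
        intro t
        rw [hg _ (by simp; linarith) (by simp; linarith)]
        · rw [Complex.ofReal_one, one_mul, fC_shift]
          congr 3
          push_cast; ring
        · intro h0
          have := congrArg Complex.im h0
          simp at this
          linarith
      simp only [Complex.ofReal_im, Complex.ofReal_re, Complex.add_im, Complex.add_re,
        Complex.I_im, Complex.I_re, add_zero, zero_add, smul_eq_mul] at h1
      simp_rw [e1, e2] at h1
      rw [intervalIntegral.integral_sub, intervalIntegral.integral_sub,
        intervalIntegral.integral_const_mul, intervalIntegral.integral_const_mul,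
        intervalIntegral.integral_const_mul] at h1
      · linear_combination h1
      · exact (continuous_const.mul hcf).intervalIntegrable _ _
      · exact (continuous_const.mul (hI _ (by linarith))).intervalIntegrable _ _
      · exact hcf.intervalIntegrable _ _
      · exact (continuous_const.mul (hI _ (by linarith))).intervalIntegrable _ _
    · intro z hz
      have := hz.2
      simp [Set.uIcc_of_le] at this
      constructor <;> linarith [this.1, this.2]
  have hb : 0 < 2 * Real.pi * min x (1 - x) := by
    have : 0 < min x (1 - x) := lt_min hx.1 (by linarith [hx.2])
    have := Real.pi_pos
    positivity
  have hB := bound_lim (2 * Real.exp (2 * Real.pi * |h|)) _ ‖r‖ hb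
  have hv1 : Filter.Tendsto (fun R : ℝ => ∫ v in (0 : ℝ)..1, g (R + v * Complex.I))
      Filter.atTop (nhds 0) := by
    apply squeeze_zero_norm' _ hB
    filter_upwards [Filter.eventually_ge_atTop 1] with R hR
    exact vert_bound x y h hx hy r g hg R (by rwa [abs_of_nonneg (by linarith)])
  have hv2 : Filter.Tendsto (fun R : ℝ => ∫ v in (0 : ℝ)..1, g ((-R : ℝ) + v * Complex.I))
      Filter.atTop (nhds 0) := by
    apply squeeze_zero_norm' _ hB
    filter_upwards [Filter.eventually_ge_atTop 1] with R hR
    have := vert_bound x y h hx hy r g hg (-R) (by rwa [abs_neg, abs_of_nonneg (by linarith)])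
    rwa [abs_neg] at this
  have hJ := intervalIntegral_tendsto_integral (fC_integrable x y h hx hy)
    Filter.tendsto_neg_atTop_atBot Filter.tendsto_id
  have hl := (hJ.const_mul (1 - L)).sub
    (((lim_inv_pos y hy0).sub (lim_inv_neg (1 - y) hy1)).const_mul r)
  have hrr := (hv2.const_mul Complex.I).sub (hv1.const_mul Complex.I)
  have heq := tendsto_nhds_unique_of_eventuallyEq hl hrr (by
    filter_upwards [Filter.eventually_ge_atTop 1] with R hR
    exact hrect R hR)
  have hpi : (Real.pi : ℂ) ≠ 0 := by exact_mod_cast Real.pi_ne_zero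
  have hr2 : r * (2 * Real.pi) = eC (-((y * x : ℝ) : ℂ)) * eC (Complex.I * h * y) := by
    rw [hr]; field_simp
  rw [← hr2]
  linear_combination heq

theorem stmt_7 (x y : ℝ) (hx : x ∈ Set.Ioo (0 : ℝ) 1) (hy : y ∈ Set.Ioo (0 : ℝ) 1)
    (h : ℝ) :
    ∫ u : ℝ, phiF u x y * eC ((u * h : ℝ) : ℂ) =
      Complex.I * eC (-((y * x : ℝ) : ℂ)) * phiF h y (1 - x) := by
  have hm := main_id x y h hx hy
  have hne : 1 - eC (((1 - x : ℝ) : ℂ) + Complex.I * h) ≠ 0 := by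
    intro h0
    obtain ⟨n, hn⟩ := eC_eq_one (sub_eq_zero.mp h0).symm
    have hre := congrArg Complex.re hn
    simp at hre
    have h1 : (n : ℝ) < 1 := by linarith [hx.1]
    have h2 : (0 : ℝ) < n := by linarith [hx.2]
    have h3 : n < 1 := by exact_mod_cast h1
    have h4 : 0 < n := by exact_mod_cast h2
    omega
  have hf : ∀ u : ℝ, phiF u x y * eC ((u * h : ℝ) : ℂ) = fC x y h u := by
    intro u
    unfold phiF fC
    push_cast
    ring
  simp_rw [hf]
  unfold phiF
  rw [← mul_div_assoc, eq_div_iff hne]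
  linear_combination hm

end
end
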